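/- For every dimension d ≥ 1 and every ε > 0 there exists a constant C = C(d, ε) > 0 such that for every finite set P ⊆ ℝ^d of n ≥ 2 points (equipped with the Euclidean metric) and every real ρ ≥ 2, there exists a (1+ε)-spanner H for P with at most C·n edges, degree Δ(H) ≤ C·ρ, hop-diameter at most C·(log_ρ n + α(ρ)), and lightness Ψ(H) ≤ C·ρ·log_ρ n. -/

import Mathlib

open scoped BigOperators

namespace Stmt0

variable {P : Type} [MetricSpace P]

/-- The weight of an edge (an unordered pair of points) is the distance between its
endpoints. -/
noncomputable def edgeWeight (e : Sym2 P) : ℝ :=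
  Sym2.lift ⟨fun p q => dist p q, fun p q => dist_comm p q⟩ e

/-- The total weight `ω(H)` of a graph, given as a finite set of edges. -/
noncomputable def totalWeight (H : Finset (Sym2 P)) : ℝ :=
  ∑ e ∈ H, edgeWeight e

/-- `H` is a graph on `P`: a finite set of unordered pairs of *distinct* points. -/
def IsGraphOn (H : Finset (Sym2 P)) : Prop :=
  ∀ e ∈ H, ¬ e.IsDiag

open Classical in
/-- The degree of the point `p` in the graph `H`: the number of edges incident on `p`. -/
noncomputable def degree (H : Finset (Sym2 P)) (p : P) : ℕ :=
  (H.filter (fun e => p ∈ e)).card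

/-- A `t`-spanner path with `k` edges between `p` and `q` in the graph `H`. -/
def IsSpannerPath (H : Finset (Sym2 P)) (t : ℝ) (p q : P) (k : ℕ) : Prop :=
  ∃ x : Fin (k + 1) → P, x 0 = p ∧ x (Fin.last k) = q ∧
    (∀ i : Fin k, s(x i.castSucc, x i.succ) ∈ H) ∧
    ∑ i : Fin k, dist (x i.castSucc) (x i.succ) ≤ t * dist p q

/-- `H` is a `t`-spanner: every pair of points admits a `t`-spanner path. -/
def IsSpanner (H : Finset (Sym2 P)) (t : ℝ) : Prop :=
  ∀ p q : P, ∃ k : ℕ, IsSpannerPath H t p q k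

/-- The graph `T` connects all the points of `P`. -/
def IsConnectedOn (T : Finset (Sym2 P)) : Prop :=
  ∀ p q : P, ∃ (k : ℕ) (x : Fin (k + 1) → P), x 0 = p ∧ x (Fin.last k) = q ∧
    ∀ i : Fin k, s(x i.castSucc, x i.succ) ∈ T

/-- `ω(MST(P))`: the minimum weight of a connected graph on `P` with `|P| - 1` edges. -/
noncomputable def mstWeight (P : Type) [MetricSpace P] [Fintype P] : ℝ :=
  sInf {w : ℝ | ∃ T : Finset (Sym2 P), IsGraphOn T ∧ IsConnectedOn T ∧
    T.card = Fintype.card P - 1 ∧ totalWeight T = w}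

/-- The inverse Ackermann function: the least `k ≥ 1` with `A(k,k) ≥ x`. -/
noncomputable def invAck (x : ℝ) : ℕ :=
  sInf {k : ℕ | 1 ≤ k ∧ x ≤ ack k k}

/-- Reachability in at most `n` steps along the pairs of `E`. -/
def Reach {α : Type*} (E : Finset (α × α)) : ℕ → α → α → Prop
  | 0, u, v => u = v
  | n + 1, u, v => ∃ w, Reach E n u w ∧ (w = v ∨ (w, v) ∈ E)

namespace Reach

variable {α : Type*} {E E' : Finset (α × α)} {m n : ℕ} {u v w : α}

theorem refl (n : ℕ) (u : α) : Reach E n u u := by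
  induction n with
  | zero => rfl
  | succ n ih => exact ⟨u, ih, Or.inl rfl⟩

theorem of_mem (h : (u, v) ∈ E) : Reach E 1 u v := ⟨u, rfl, Or.inr h⟩

theorem mono (hE : E ⊆ E') (h : Reach E n u v) : Reach E' n u v := by
  induction n generalizing v with
  | zero => exact h
  | succ n ih =>
    obtain ⟨w, hw, h⟩ := h
    exact ⟨w, ih hw, h.imp id fun h => hE h⟩

theorem trans (h : Reach E m u v) (h' : Reach E n v w) : Reach E (m + n) u w := by
  induction n generalizing w with
  | zero => cases h'; exact h
  | succ n ih =>
    obtain ⟨x, hx, h'⟩ := h'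
    exact ⟨x, ih hx, h'⟩

theorem mono_steps (hmn : m ≤ n) (h : Reach E m u v) : Reach E n u v := by
  obtain ⟨k, rfl⟩ := Nat.exists_eq_add_of_le hmn
  exact h.trans (refl k v)

end Reach

/-- A rooted forest on `V` given by depths and ancestors: `anc u k` is the ancestor of `u`
at depth `k ≤ dep u`. -/
structure IsForest {α : Type*} (V : Finset α) (dep : α → ℕ) (anc : α → ℕ → α) : Prop where
  mem : ∀ {u k}, u ∈ V → k ≤ dep u → anc u k ∈ V
  dep_anc : ∀ {u k}, u ∈ V → k ≤ dep u → dep (anc u k) = k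
  anc_anc : ∀ {u j k}, u ∈ V → j ≤ k → k ≤ dep u → anc (anc u k) j = anc u j
  anc_self : ∀ {u}, u ∈ V → anc u (dep u) = u

/-- There are `m` pairs (descendant, ancestor) through which every vertex of the forest reaches
each of its ancestors in at most `N` steps. -/
def HasShortcut {α : Type*} (V : Finset α) (dep : α → ℕ) (anc : α → ℕ → α) (N m : ℕ) : Prop :=
  ∃ E : Finset (α × α), E.card ≤ m ∧ (∀ e ∈ E, e.1 ∈ V ∧ ∃ j ≤ dep e.1, e.2 = anc e.1 j) ∧
    ∀ u ∈ V, ∀ j ≤ dep u, Reach E N u (anc u j)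

/-- The depth of forests that are shortcut to `2 * k + 1` steps by `3 * s + 12` pairs
per vertex. -/
def shortcutDepth : ℕ → ℕ → ℕ
  | 0, s => s + 12
  | _ + 1, 0 => 12
  | k + 1, s + 1 => shortcutDepth (k + 1) s * shortcutDepth k ((shortcutDepth (k + 1) s - 12) / 3)

theorem twelve_le_shortcutDepth (k s : ℕ) : 12 ≤ shortcutDepth k s := by
  induction k generalizing s with
  | zero => simp [shortcutDepth]
  | succ k ihk =>
    induction s with
    | zero => simp [shortcutDepth]
    | succ s ih =>
      rw [shortcutDepth]
      nlinarith [ihk ((shortcutDepth (k + 1) s - 12) / 3)]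

theorem twelve_mul_shortcutDepth_le (k s : ℕ) :
    12 * shortcutDepth (k + 1) s ≤ shortcutDepth (k + 1) (s + 1) := by
  rw [shortcutDepth, mul_comm]
  exact Nat.mul_le_mul_left _ (twelve_le_shortcutDepth _ _)

theorem shortcutDepth_le_succ (k s : ℕ) :
    shortcutDepth k ((shortcutDepth (k + 1) s - 12) / 3) ≤ shortcutDepth (k + 1) (s + 1) := by
  rw [shortcutDepth]
  exact Nat.le_mul_of_pos_left _ (by linarith [twelve_le_shortcutDepth (k + 1) s])

theorem shortcutDepth_mono (k : ℕ) : Monotone (shortcutDepth k) := by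
  refine monotone_nat_of_le_succ fun s => ?_
  cases k with
  | zero => simp [shortcutDepth]
  | succ k => linarith [twelve_mul_shortcutDepth_le k s]

theorem ack_le_shortcutDepth (k n : ℕ) :
    3 * (ack k n + 2) + 12 ≤ shortcutDepth (k + 1) (n + 2) := by
  induction k generalizing n with
  | zero =>
    induction n with
    | zero => simp [shortcutDepth]
    | succ n ih =>
      have := twelve_mul_shortcutDepth_le 0 (n + 2)
      simp only [ack_zero] at ih ⊢
      have h : n + 1 + 2 = n + 2 + 1 := by ring
      rw [h]
      omega
  | succ k ihk =>
    induction n with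
    | zero =>
      rw [ack_succ_zero]
      refine (ihk 1).trans ((shortcutDepth_mono _ ?_).trans (shortcutDepth_le_succ (k + 1) 1))
      have := twelve_mul_shortcutDepth_le (k + 1) 0
      have h2 : shortcutDepth (k + 1 + 1) 0 = 12 := by rw [shortcutDepth]
      simp only [zero_add] at this
      omega
    | succ n ih =>
      rw [ack_succ_succ]
      refine (ihk _).trans
        ((shortcutDepth_mono _ ?_).trans (shortcutDepth_le_succ (k + 1) (n + 2)))
      omega

theorem ack_self_le_shortcutDepth (k : ℕ) : ack k k ≤ shortcutDepth (k + 2) 3 := by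
  have h1 := ack_le_shortcutDepth k (k + 1)
  have h2 := shortcutDepth_le_succ (k + 1) 2
  have h3 := ack_le_shortcutDepth (k + 1) 0
  have h4 : k + 1 + 0 < ack (k + 1) 0 := add_lt_ack _ _
  have h5 : ack k k ≤ ack k (k + 1) := ack_le_ack le_rfl (Nat.le_succ k)
  have h6 : shortcutDepth (k + 1) (k + 1 + 2) ≤
      shortcutDepth (k + 1) ((shortcutDepth (k + 1 + 1) 2 - 12) / 3) := by
    apply shortcutDepth_mono
    simp only [zero_add] at h3
    omega
  simp only [show 2 + 1 = 3 from rfl, show k + 1 + 1 = k + 2 from rfl] at *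
  omega

theorem hasShortcut_of_dep_lt {α : Type*} {V : Finset α} {dep : α → ℕ} {anc : α → ℕ → α} {m : ℕ}
    (hm : ∀ u ∈ V, dep u < m) : HasShortcut V dep anc 1 (m * V.card) := by
  classical
  refine ⟨V.biUnion fun u => (Finset.range (dep u + 1)).image fun j => (u, anc u j), ?_, ?_, ?_⟩
  · rw [mul_comm]
    refine Finset.card_biUnion_le_card_mul _ _ _ fun u hu => ?_
    refine Finset.card_image_le.trans ?_
    simpa using hm u hu
  · simp only [Finset.mem_biUnion, Finset.mem_image, Finset.mem_range]
    rintro _ ⟨u, hu, j, hj, rfl⟩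
    exact ⟨hu, j, Nat.lt_succ_iff.mp hj, rfl⟩
  · intro u hu j hj
    refine Reach.of_mem ?_
    simp only [Finset.mem_biUnion, Finset.mem_image, Finset.mem_range]
    exact ⟨u, hu, j, by omega, rfl⟩

theorem IsForest.band {α : Type*} {V : Finset α} {dep : α → ℕ} {anc : α → ℕ → α}
    (hF : IsForest V dep anc) (base : ℕ → ℕ) (hbase : ∀ k, base k ≤ k)
    (hbase' : ∀ k j, base k ≤ j → j ≤ k → base j = base k) :
    IsForest V (fun u => dep u - base (dep u)) (fun u k => anc u (base (dep u) + k)) where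
  mem {u k} hu hk := hF.mem hu (by have := hbase (dep u); omega)
  dep_anc {u k} hu hk := by
    have := hbase (dep u)
    have h := hbase' (dep u) (base (dep u) + k) (by omega) (by omega)
    simp only [hF.dep_anc hu (by omega : base (dep u) + k ≤ dep u), h]
    omega
  anc_anc {u j k} hu hjk hk := by
    have := hbase (dep u)
    have h := hbase' (dep u) (base (dep u) + k) (by omega) (by omega)
    simp only [hF.dep_anc hu (by omega : base (dep u) + k ≤ dep u), h]
    exact hF.anc_anc hu (by omega) (by omega)
  anc_self {u} hu := by
    rw [Nat.add_sub_cancel' (hbase _), hF.anc_self hu]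

theorem IsForest.boundary {α : Type*} {V : Finset α} {dep : α → ℕ} {anc : α → ℕ → α}
    (hF : IsForest V dep anc) {c g : ℕ} (hg : 0 < g) :
    IsForest (V.filter fun v => c ≤ dep v ∧ (dep v - c) % g = 0) (fun u => (dep u - c) / g)
      (fun u k => anc u (c + g * k)) := by
  have key : ∀ {u k}, u ∈ V.filter (fun v => c ≤ dep v ∧ (dep v - c) % g = 0) →
      k ≤ (dep u - c) / g → c + g * k ≤ dep u := by
    intro u k hu hk
    obtain ⟨_, h1, _⟩ := Finset.mem_filter.mp hu
    have := (Nat.mul_le_mul_left g hk).trans (Nat.mul_div_le (dep u - c) g)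
    omega
  constructor
  · intro u k hu hk
    have h := key hu hk
    have hV := (Finset.mem_filter.mp hu).1
    refine Finset.mem_filter.mpr ⟨hF.mem hV h, ?_⟩
    rw [hF.dep_anc hV h]
    simp
  · intro u k hu hk
    rw [hF.dep_anc (Finset.mem_filter.mp hu).1 (key hu hk)]
    simp [hg]
  · intro u j k hu hjk hk
    exact hF.anc_anc (Finset.mem_filter.mp hu).1
      (by have := Nat.mul_le_mul_left g hjk; omega) (key hu hk)
  · intro u hu
    obtain ⟨hV, h1, h2⟩ := Finset.mem_filter.mp hu
    have h3 : g * ((dep u - c) / g) = dep u - c :=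
      Nat.mul_div_cancel' (Nat.dvd_of_mod_eq_zero h2)
    rw [h3, Nat.add_sub_cancel' h1, hF.anc_self hV]

/-- Some residue class of depths modulo `g` holds at most a `g`-th of the vertices. -/
theorem exists_sparse_residue {α : Type*} (V : Finset α) (dep : α → ℕ) {g : ℕ} (hg : 0 < g) :
    ∃ c < g, g * (V.filter fun v => c ≤ dep v ∧ (dep v - c) % g = 0).card ≤ V.card := by
  classical
  by_contra! h
  have h1 : ∀ c ∈ Finset.range g, V.card < g * (V.filter fun v => dep v % g = c).card := by
    intro c hc
    have hc := Finset.mem_range.mp hc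
    refine (h c hc).trans_le (Nat.mul_le_mul_left _ (Finset.card_le_card ?_))
    intro v hv
    simp only [Finset.mem_filter] at hv ⊢
    refine ⟨hv.1, ?_⟩
    obtain ⟨q, hq⟩ := Nat.dvd_of_mod_eq_zero hv.2.2
    have : dep v = c + g * q := by omega
    rw [this, Nat.add_mul_mod_self_left, Nat.mod_eq_of_lt hc]
  have h2 := Finset.sum_lt_sum_of_nonempty (Finset.nonempty_range_iff.mpr hg.ne') h1
  rw [← Finset.mul_sum, Finset.sum_const, Finset.card_range, smul_eq_mul,
    ← Finset.card_eq_sum_card_fiberwise (t := Finset.range g)] at h2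
  · exact lt_irrefl _ h2
  · intro v _
    simpa using Nat.mod_lt _ hg

/-- The first depth of the band of depth `k`, bands being separated at the depths congruent
to `c` modulo `g`. -/
def bandBase (c g k : ℕ) : ℕ := if k < c then 0 else k - (k - c) % g

theorem bandBase_le (c g k : ℕ) : bandBase c g k ≤ k := by
  unfold bandBase; split_ifs <;> omega

theorem bandBase_eq {c g k : ℕ} (h : c ≤ k) : bandBase c g k = c + g * ((k - c) / g) := by
  rw [bandBase, if_neg (by omega)]
  have := Nat.div_add_mod (k - c) g
  omega

theorem bandBase_congr {c g k j : ℕ} (h1 : bandBase c g k ≤ j) (h2 : j ≤ k) :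
    bandBase c g j = bandBase c g k := by
  by_cases hk : k < c
  · simp [bandBase, hk, h2.trans_lt hk]
  · rw [bandBase_eq (by omega)] at h1 ⊢
    rw [bandBase_eq (by omega)]
    congr 2
    apply le_antisymm
    · exact Nat.div_le_div_right (by omega)
    · rcases Nat.eq_zero_or_pos g with rfl | hg
      · simp
      · rw [Nat.le_div_iff_mul_le hg, mul_comm]
        omega

theorem sub_bandBase_lt {c g : ℕ} (hc : c < g) (k : ℕ) : k - bandBase c g k < g := by
  unfold bandBase
  split_ifs with h
  · omega
  · have := Nat.mod_lt (k - c) (by omega : 0 < g)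
    omega

theorem hasShortcut_shortcutDepth {α : Type*} (k s : ℕ) :
    ∀ {V : Finset α} {dep : α → ℕ} {anc : α → ℕ → α}, IsForest V dep anc →
      (∀ u ∈ V, dep u < shortcutDepth k s) →
      HasShortcut V dep anc (2 * k + 1) ((3 * s + 12) * V.card) := by
  classical
  induction k generalizing s with
  | zero =>
    intro V dep anc hF hV
    obtain ⟨E, h1, h2⟩ := hasShortcut_of_dep_lt (anc := anc) hV
    exact ⟨E, h1.trans (Nat.mul_le_mul_right _ (by simp only [shortcutDepth]; omega)), h2⟩
  | succ k ihk =>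
    induction s with
    | zero =>
      intro V dep anc hF hV
      obtain ⟨E, h1, h2, h3⟩ := hasShortcut_of_dep_lt (anc := anc) hV
      exact ⟨E, by simpa [shortcutDepth] using h1, h2,
        fun u hu j hj => (h3 u hu j hj).mono_steps (by omega)⟩
    | succ s ihs =>
      intro V dep anc hF hV
      set g := shortcutDepth (k + 1) s with hg
      have hg12 : 12 ≤ g := twelve_le_shortcutDepth _ _
      obtain ⟨c, hcg, hcard⟩ := exists_sparse_residue V dep (g := g) (by omega)
      set Bd := V.filter fun v => c ≤ dep v ∧ (dep v - c) % g = 0 with hBd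
      obtain ⟨E₁, hE₁, hE₁', hR₁⟩ := ihs (hF.band (bandBase c g) (bandBase_le c g)
        fun k j => bandBase_congr) fun u _ => sub_bandBase_lt hcg _
      obtain ⟨E₂, hE₂, hE₂', hR₂⟩ := ihk ((g - 12) / 3) (hF.boundary (c := c) (g := g) (by omega))
        (by
          intro u hu
          have := hV u (Finset.mem_filter.mp hu).1
          rw [shortcutDepth, ← hg] at this
          exact Nat.div_lt_of_lt_mul (by omega))
      set E₃ := (V.filter fun u => c ≤ dep u).image fun u => (u, anc u (bandBase c g (dep u)))
        with hE₃
      set E₄ := Bd.biUnion fun v => ((Finset.range g).filter fun i => i ≤ dep v).image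
        fun i => (v, anc v (dep v - i)) with hE₄
      refine ⟨E₁ ∪ E₂ ∪ E₃ ∪ E₄, ?_, ?_, ?_⟩
      · have h3 : E₃.card ≤ V.card := Finset.card_image_le.trans (Finset.card_filter_le _ _)
        have h4 : E₄.card ≤ Bd.card * g := by
          refine Finset.card_biUnion_le_card_mul _ _ _ fun v _ => Finset.card_image_le.trans ?_
          exact (Finset.card_filter_le _ _).trans (by simp)
        have h2 : E₂.card ≤ V.card := by
          refine hE₂.trans (le_trans (Nat.mul_le_mul_right _ ?_) hcard)
          omega
        have h5 := Finset.card_union_le (E₁ ∪ E₂ ∪ E₃) E₄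
        have h6 := Finset.card_union_le (E₁ ∪ E₂) E₃
        have h7 := Finset.card_union_le E₁ E₂
        nlinarith
      · intro e he
        simp only [Finset.mem_union] at he
        rcases he with ((he | he) | he) | he
        · obtain ⟨h1, j, hj, h2⟩ := hE₁' e he
          simp only at hj
          have := bandBase_le c g (dep e.1)
          exact ⟨h1, _, by omega, h2⟩
        · obtain ⟨h1, j, hj, h2⟩ := hE₂' e he
          obtain ⟨h1, h3, _⟩ := Finset.mem_filter.mp h1
          have := (Nat.mul_le_mul_left g hj).trans (Nat.mul_div_le (dep e.1 - c) g)
          exact ⟨h1, _, by omega, h2⟩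
        · obtain ⟨u, hu, rfl⟩ := Finset.mem_image.mp he
          exact ⟨(Finset.mem_filter.mp hu).1, _, bandBase_le _ _ _, rfl⟩
        · obtain ⟨v, hv, he⟩ := Finset.mem_biUnion.mp he
          obtain ⟨i, _, rfl⟩ := Finset.mem_image.mp he
          exact ⟨(Finset.mem_filter.mp hv).1, _, Nat.sub_le _ _, rfl⟩
      · intro u hu j hj
        by_cases hband : bandBase c g (dep u) ≤ j
        · have h := hR₁ u hu (j - bandBase c g (dep u)) (by simp only; omega)
          simp only [Nat.add_sub_cancel' hband] at h
          exact h.mono fun e he => by simp [he]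
        · push Not at hband
          have hcu : c ≤ dep u := by
            by_contra h
            rw [bandBase, if_pos (by omega)] at hband
            omega
          set q := (dep u - c) / g with hq
          have hbq : bandBase c g (dep u) = c + g * q := bandBase_eq hcu
          set m := (j + (g - 1) - c) / g with hm
          have hm1 : g * m ≤ j + (g - 1) - c := Nat.mul_div_le _ _
          have hm2 : j + (g - 1) - c < g * (m + 1) := Nat.lt_mul_div_succ _ (by omega)
          rw [mul_add, mul_one] at hm2
          have hmq : m ≤ q := by
            by_contra hlt
            have := Nat.mul_le_mul_left g (Nat.succ_le_of_lt (not_le.mp hlt))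
            rw [Nat.mul_succ] at this
            omega
          have hgmq := Nat.mul_le_mul_left g hmq
          have hbu : c + g * q ≤ dep u := hbq ▸ bandBase_le c g (dep u)
          have hb₁ : anc u (c + g * q) ∈ Bd := by
            refine Finset.mem_filter.mpr ⟨hF.mem hu hbu, ?_⟩
            rw [hF.dep_anc hu hbu]
            simp
          have hb₂ : anc u (c + g * m) ∈ Bd := by
            refine Finset.mem_filter.mpr ⟨hF.mem hu (by omega), ?_⟩
            rw [hF.dep_anc hu (by omega)]
            simp
          have r₁ : Reach E₃ 1 u (anc u (c + g * q)) := by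
            refine Reach.of_mem (Finset.mem_image.mpr ⟨u, ?_, by rw [hbq]⟩)
            exact Finset.mem_filter.mpr ⟨hu, hcu⟩
          have r₂ : Reach E₂ (2 * k + 1) (anc u (c + g * q)) (anc u (c + g * m)) := by
            have h := hR₂ _ hb₁ m (by
              simp only [hF.dep_anc hu hbu]
              simpa [Nat.mul_div_cancel_left _ (by omega : 0 < g)] using hmq)
            simpa only [hF.anc_anc hu (by omega : c + g * m ≤ c + g * q) hbu] using h
          have r₃ : Reach E₄ 1 (anc u (c + g * m)) (anc u j) := by
            refine Reach.of_mem (Finset.mem_biUnion.mpr ⟨_, hb₂, Finset.mem_image.mpr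
              ⟨c + g * m - j, ?_, ?_⟩⟩)
            · rw [hF.dep_anc hu (by omega)]
              simp only [Finset.mem_filter, Finset.mem_range]
              omega
            · rw [hF.dep_anc hu (by omega), Nat.sub_sub_self (by omega),
                hF.anc_anc hu (by omega) (by omega)]
          have := ((r₁.mono (E' := E₁ ∪ E₂ ∪ E₃ ∪ E₄) fun e he => by simp [he]).trans
            (r₂.mono fun e he => by simp [he])).trans (r₃.mono fun e he => by simp [he])
          exact this.mono_steps (by omega)

/-- Shortcuts for a finite set with a forest order, `A u` being the set of elements above `u`. -/
theorem exists_shortcut {α : Type*} {V : Finset α} {A : α → Finset α} {k : ℕ}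
    (hmem : ∀ u ∈ V, A u ⊆ V) (hself : ∀ u ∈ V, u ∈ A u)
    (htrans : ∀ u ∈ V, ∀ v ∈ A u, A v ⊆ A u)
    (hchain : ∀ u ∈ V, ∀ v ∈ A u, ∀ w ∈ A u, v ∈ A w ∨ w ∈ A v)
    (hanti : ∀ u ∈ V, ∀ v ∈ A u, u ∈ A v → u = v)
    (hcard : ∀ u ∈ V, (A u).card ≤ ack k k) :
    ∃ E : Finset (α × α), E.card ≤ 22 * V.card ∧ (∀ e ∈ E, e.1 ∈ V ∧ e.2 ∈ A e.1) ∧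
      (∀ u ∈ V, ∀ v ∈ A u, Reach E (2 * k + 5) u v) ∧
      ∀ u ∈ V, ∀ v ∈ A u, A v = {v} → (u, v) ∈ E := by
  classical
  have hlt : ∀ u ∈ V, ∀ v ∈ A u, v ≠ u → (A v).card < (A u).card := by
    intro u hu v hv hne
    refine Finset.card_lt_card ⟨htrans u hu v hv, fun h => hne ?_⟩
    exact (hanti u hu v hv (h (hself u hu))).symm
  have hinj : ∀ u ∈ V, Set.InjOn (fun v => (A v).card) (A u : Set α) := by
    intro u hu v hv w hw hvw
    by_contra hne
    rcases hchain u hu v hv w hw with h | h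
    · exact (hlt w (hmem u hu hw) v h hne).ne hvw
    · exact (hlt v (hmem u hu hv) w h (Ne.symm hne)).ne hvw.symm
  have hpos : ∀ u ∈ V, 0 < (A u).card := fun u hu => Finset.card_pos.mpr ⟨u, hself u hu⟩
  have hex : ∀ u ∈ V, ∀ j < (A u).card, ∃ v ∈ A u, (A v).card = j + 1 := by
    intro u hu j hj
    have himg : (A u).image (fun v => (A v).card) = Finset.Icc 1 (A u).card := by
      refine Finset.eq_of_subset_of_card_le ?_ ?_
      · intro c hc
        obtain ⟨v, hv, rfl⟩ := Finset.mem_image.mp hc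
        exact Finset.mem_Icc.mpr ⟨hpos v (hmem u hu hv), Finset.card_le_card (htrans u hu v hv)⟩
      · rw [Finset.card_image_of_injOn (hinj u hu)]
        simp
    have : j + 1 ∈ (A u).image (fun v => (A v).card) := by
      rw [himg, Finset.mem_Icc]; omega
    simpa using this
  have hex' : ∀ (u : α) (j : ℕ), ∃ v, u ∈ V → j ≤ (A u).card - 1 → v ∈ A u ∧ (A v).card = j + 1 := by
    intro u j
    by_cases hu : u ∈ V
    · by_cases hj : j ≤ (A u).card - 1
      · obtain ⟨v, h⟩ := hex u hu j (by have := hpos u hu; omega)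
        exact ⟨v, fun _ _ => h⟩
      · exact ⟨u, fun _ h => absurd h hj⟩
    · exact ⟨u, fun h => absurd h hu⟩
  choose anc hanc using hex'
  have hF : IsForest V (fun u => (A u).card - 1) anc := by
    constructor
    · intro u j hu hj
      exact hmem u hu (hanc u j hu hj).1
    · intro u j hu hj
      simp [(hanc u j hu hj).2]
    · intro u i j hu hij hj
      have hj' := hanc u j hu hj
      have hi := hanc u i hu (hij.trans hj)
      have hij' := hanc (anc u j) i (hmem u hu hj'.1) (by omega)
      exact hinj u hu (htrans u hu _ hj'.1 hij'.1) hi.1 (by simp [hi.2, hij'.2])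
    · intro u hu
      have h := hanc u _ hu le_rfl
      have := hpos u hu
      exact hinj u hu h.1 (hself u hu) (by simp only [h.2]; omega)
  have heq : ∀ u ∈ V, ∀ v ∈ A u, v = anc u ((A v).card - 1) := by
    intro u hu v hv
    have hc := Finset.card_le_card (htrans u hu v hv)
    have h := hanc u ((A v).card - 1) hu (by omega)
    have := hpos v (hmem u hu hv)
    exact hinj u hu hv h.1 (by simp only [h.2]; omega)
  obtain ⟨E, hE, hE', hR⟩ := hasShortcut_shortcutDepth (k + 2) 3 hF (by
    intro u hu
    have := hcard u hu
    have := ack_self_le_shortcutDepth k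
    have := hpos u hu
    omega)
  refine ⟨E ∪ V.image fun u => (u, anc u 0), ?_, ?_, ?_, ?_⟩
  · have h1 := Finset.card_union_le E (V.image fun u => (u, anc u 0))
    have h2 : (V.image fun u => (u, anc u 0)).card ≤ V.card := Finset.card_image_le
    omega
  · intro e he
    rcases Finset.mem_union.mp he with he | he
    · obtain ⟨h1, j, hj, h2⟩ := hE' e he
      exact ⟨h1, h2 ▸ (hanc _ j h1 hj).1⟩
    · obtain ⟨u, hu, rfl⟩ := Finset.mem_image.mp he
      exact ⟨hu, (hanc u 0 hu (Nat.zero_le _)).1⟩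
  · intro u hu v hv
    have hc := Finset.card_le_card (htrans u hu v hv)
    have h := hR u hu ((A v).card - 1) (by simp only; omega)
    rw [← heq u hu v hv] at h
    exact h.mono Finset.subset_union_left
  · intro u hu v hv hA
    refine Finset.mem_union_right _ (Finset.mem_image.mpr ⟨u, hu, ?_⟩)
    have := heq u hu v hv
    rw [hA, Finset.card_singleton] at this
    rw [← this]

open Classical in
/-- A star of bounded degree: the members of `S`, sorted by injective keys, are attached to the
center (`none`) or to members with larger keys, so that heavy members are attached close to the
center. -/
theorem exists_star_parent {ι : Type*} {r : ℕ} (hr : 0 < r) (key w : ι → ℕ) (S : Finset ι)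
    (hinj : Set.InjOn key S) (hw : ∀ i ∈ S, 1 ≤ w i) :
    ∃ (π : ι → Option ι) (dpt : ι → ℕ),
      (∀ i ∈ S, ∀ j, π i = some j → j ∈ S ∧ key i < key j ∧ dpt i = dpt j + 1) ∧
      (∀ i ∈ S, π i = none → dpt i = 1) ∧
      (∀ i ∈ S, 1 ≤ dpt i ∧ r ^ (dpt i - 1) * w i ≤ ∑ j ∈ S, w j) ∧
      (∀ j ∈ S, {i ∈ S | π i = some j}.card ≤ 2 * r) ∧
      {i ∈ S | π i = none}.card ≤ 2 * r := by
  induction hn : S.card using Nat.strong_induction_on generalizing S with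
  | _ n ih =>
  subst hn
  rcases S.eq_empty_or_nonempty with rfl | hS
  · exact ⟨fun _ => none, fun _ => 1, by simp⟩
  set W := ∑ j ∈ S, w j with hW
  set pre : ι → ℕ := fun i => ∑ j ∈ S with key i < key j, w j with hpre
  set q : ι → ℕ := fun i => pre i * r / W with hq
  have hprelt : ∀ i ∈ S, pre i + w i ≤ W := by
    intro i hi
    have : insert i {j ∈ S | key i < key j} ⊆ S := by
      intro j; simp only [Finset.mem_insert, Finset.mem_filter]; rintro (rfl | h); exacts [hi, h.1]
    have h := Finset.sum_le_sum_of_subset (f := w) this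
    rw [Finset.sum_insert (by simp)] at h
    simp only [hpre]; omega
  have hWpos : 0 < W := by
    obtain ⟨i, hi⟩ := hS
    have := hprelt i hi; have := hw i hi; omega
  have hqlt : ∀ i ∈ S, q i < r := by
    intro i hi
    have := hprelt i hi; have := hw i hi
    simp only [hq]
    rw [Nat.div_lt_iff_lt_mul hWpos, mul_comm]
    exact Nat.mul_lt_mul_of_pos_left (by omega) hr
  -- the first (largest key) and last (smallest key) members of each group
  have hends : ∀ g, ∃ f l, {i ∈ S | q i = g}.Nonempty →
      (f ∈ S ∧ q f = g ∧ l ∈ S ∧ q l = g ∧ ∀ i ∈ S, q i = g → key i ≤ key f ∧ key l ≤ key i) := by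
    intro g
    by_cases hg : {i ∈ S | q i = g}.Nonempty
    · obtain ⟨f, hf, hf'⟩ := Finset.exists_max_image _ key hg
      obtain ⟨l, hl, hl'⟩ := Finset.exists_min_image _ key hg
      rw [Finset.mem_filter] at hf hl
      exact ⟨f, l, fun _ => ⟨hf.1, hf.2, hl.1, hl.2, fun i hi hi' =>
        ⟨hf' i (Finset.mem_filter.mpr ⟨hi, hi'⟩), hl' i (Finset.mem_filter.mpr ⟨hi, hi'⟩)⟩⟩⟩
    · obtain ⟨i, hi⟩ := hS
      exact ⟨i, i, fun h => absurd h hg⟩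
  choose f l hfl using hends
  have hfl' : ∀ i ∈ S, f (q i) ∈ S ∧ q (f (q i)) = q i ∧ l (q i) ∈ S ∧ q (l (q i)) = q i ∧
      key i ≤ key (f (q i)) ∧ key (l (q i)) ≤ key i := by
    intro i hi
    obtain ⟨h1, h2, h3, h4, h5⟩ := hfl (q i) ⟨i, by simp [hi]⟩
    exact ⟨h1, h2, h3, h4, h5 i hi rfl⟩
  set rest : ℕ → Finset ι := fun g => {i ∈ S | q i = g ∧ i ≠ f g ∧ i ≠ l g} with hrest
  have hmem : ∀ g i, i ∈ rest g ↔ i ∈ S ∧ q i = g ∧ i ≠ f g ∧ i ≠ l g := by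
    intro g i; simp [hrest]
  have hsub : ∀ g, rest g ⊆ S := fun g => Finset.filter_subset _ _
  have hcard : ∀ g, (rest g).card < S.card := by
    intro g
    rcases (rest g).eq_empty_or_nonempty with h | ⟨i, hi⟩
    · rw [h]; simpa using hS.card_pos
    · apply Finset.card_lt_card
      refine ⟨hsub g, fun h => ?_⟩
      rw [hmem] at hi
      have h1 := (hfl' i hi.1).1
      rw [hi.2.1] at h1
      exact ((hmem g (f g)).mp (h h1)).2.2.1 rfl
  have hweight : ∀ g, r * ∑ j ∈ rest g, w j ≤ W := by
    intro g
    rcases (rest g).eq_empty_or_nonempty with h | ⟨i, hi⟩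
    · rw [h]; simp
    · rw [hmem] at hi
      obtain ⟨h1, h2, h3, h4, -⟩ := hfl' i hi.1
      rw [hi.2.1] at h1 h2 h3 h4
      have hle : ∑ j ∈ rest g, w j + pre (f g) ≤ pre (l g) := by
        have hd : Disjoint (rest g) {j ∈ S | key (f g) < key j} := by
          rw [Finset.disjoint_left]
          intro j hj hj'
          rw [hmem] at hj
          have := (hfl' j hj.1).2.2.2.2.1
          rw [hj.2.1] at this
          have := (Finset.mem_filter.mp hj').2
          omega
        simp only [hpre]
        rw [← Finset.sum_union hd]
        apply Finset.sum_le_sum_of_subset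
        have hlf : key (l g) ≤ key (f g) := by
          have := (hfl' _ h1).2.2.2.2.2
          rwa [h2] at this
        intro j hj
        rw [Finset.mem_filter]
        rcases Finset.mem_union.mp hj with hj | hj
        · rw [hmem] at hj
          have := (hfl' j hj.1).2.2.2.2.2
          rw [hj.2.1] at this
          refine ⟨hj.1, lt_of_le_of_ne this fun h => hj.2.2.2 (hinj hj.1 h3 h.symm)⟩
        · rw [Finset.mem_filter] at hj
          exact ⟨hj.1, by omega⟩
      have hl : pre (l g) * r < (g + 1) * W := by
        rw [← Nat.div_lt_iff_lt_mul hWpos]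
        have : pre (l g) * r / W = g := h4
        omega
      have hf : g * W ≤ pre (f g) * r := by
        rw [← Nat.le_div_iff_mul_le hWpos]
        exact h2.ge
      nlinarith
  have hrec := fun g => ih _ (hcard g) (rest g) (hinj.mono (hsub g)) (fun i hi => hw i (hsub g hi)) rfl
  choose π dpt hπ1 hπ2 hπ3 hπ4 hπ5 using hrec
  set E : ι → Prop := fun i => i = f (q i) ∨ i = l (q i) with hE
  have hnE : ∀ i ∈ S, ¬ E i → i ∈ rest (q i) := by
    intro i hi h
    rw [hE, not_or] at h
    exact (hmem _ _).mpr ⟨hi, rfl, h⟩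
  have hEr : ∀ g, ∀ i ∈ rest g, ¬ E i ∧ q i = g := by
    intro g i hi
    obtain ⟨-, rfl, h⟩ := (hmem _ _).mp hi
    exact ⟨not_or.mpr h, rfl⟩
  set π' : ι → Option ι := fun i => if E i then none else some ((π (q i) i).getD (f (q i))) with hπ'
  set dpt' : ι → ℕ := fun i => if E i then 1 else dpt (q i) i + 1 with hdpt'
  have hEf : ∀ i ∈ S, E (f (q i)) := fun i hi => Or.inl (by rw [(hfl' i hi).2.1])
  refine ⟨π', dpt', ?_, ?_, ?_, ?_, ?_⟩
  · intro i hi j hj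
    by_cases hEi : E i
    · simp [hπ', hEi] at hj
    have hir := hnE i hi hEi
    simp only [hπ', hEi, if_false, Option.some.injEq] at hj
    rcases hp : π (q i) i with _ | j'
    · rw [hp] at hj
      simp only [Option.getD_none] at hj
      subst hj
      have h := hfl' i hi
      refine ⟨h.1, lt_of_le_of_ne h.2.2.2.2.1 fun h' => hEi (Or.inl (hinj hi h.1 h')), ?_⟩
      simp [hdpt', hEi, hEf i hi, hπ2 _ i hir hp]
    · rw [hp] at hj
      simp only [Option.getD_some] at hj
      subst hj
      obtain ⟨h1, h2, h3⟩ := hπ1 _ i hir j' hp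
      obtain ⟨h4, h5⟩ := hEr _ _ h1
      refine ⟨hsub _ h1, h2, ?_⟩
      simp [hdpt', hEi, h4, h5, h3]
  · intro i hi h
    by_cases hEi : E i
    · simp [hdpt', hEi]
    · simp [hπ', hEi] at h
  · intro i hi
    by_cases hEi : E i
    · have := hprelt i hi
      simp [hdpt', hEi]; omega
    · obtain ⟨h1, h2⟩ := hπ3 _ i (hnE i hi hEi)
      simp only [hdpt', hEi, if_false, Nat.add_sub_cancel]
      refine ⟨by omega, ?_⟩
      calc r ^ dpt (q i) i * w i = r * (r ^ (dpt (q i) i - 1) * w i) := by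
            rw [← mul_assoc, ← pow_succ', Nat.sub_add_cancel h1]
        _ ≤ _ := (Nat.mul_le_mul_left r h2).trans (hweight _)
  · intro j hj
    by_cases hjr : E j
    · by_cases hjf : j = f (q j)
      · refine (Finset.card_le_card ?_).trans (hπ5 (q j))
        intro i hi
        rw [Finset.mem_filter] at hi ⊢
        by_cases hEi : E i
        · simp [hπ', hEi] at hi
        have hir := hnE i hi.1 hEi
        simp only [hπ', hEi, if_false, Option.some.injEq] at hi
        rcases hp : π (q i) i with _ | j'
        · rw [hp] at hi
          have h1 := (hfl' i hi.1).2.1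
          have h2 : f (q i) = j := hi.2
          rw [h2] at h1
          rw [h1]; exact ⟨hir, hp⟩
        · rw [hp] at hi
          have h2 : j' = j := hi.2
          subst h2
          exact absurd hjr (hEr _ _ (hπ1 _ i hir j' hp).1).1
      · rw [Finset.card_eq_zero.mpr]; · omega
        rw [Finset.filter_eq_empty_iff]
        intro i hi h
        by_cases hEi : E i
        · simp [hπ', hEi] at h
        have hir := hnE i hi hEi
        simp only [hπ', hEi, if_false, Option.some.injEq] at h
        rcases hp : π (q i) i with _ | j'
        · rw [hp] at h
          have h2 : f (q i) = j := h
          exact hjf (by rw [← h2, (hfl' i hi).2.1])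
        · rw [hp] at h
          have h2 : j' = j := h
          subst h2
          exact absurd hjr (hEr _ _ (hπ1 _ i hir j' hp).1).1
    · refine (Finset.card_le_card ?_).trans (hπ4 (q j) j (hnE j hj hjr))
      intro i hi
      rw [Finset.mem_filter] at hi ⊢
      by_cases hEi : E i
      · simp [hπ', hEi] at hi
      have hir := hnE i hi.1 hEi
      simp only [hπ', hEi, if_false, Option.some.injEq] at hi
      rcases hp : π (q i) i with _ | j'
      · rw [hp] at hi
        have h2 : f (q i) = j := hi.2
        exact absurd (hEf i hi.1) (h2 ▸ hjr)
      · rw [hp] at hi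
        have h2 : j' = j := hi.2
        subst h2
        have h3 := (hEr _ _ (hπ1 _ i hir j' hp).1).2
        rw [h3]; exact ⟨hir, hp⟩
  · have : {i ∈ S | π' i = none} ⊆ (Finset.range r).image f ∪ (Finset.range r).image l := by
      intro i hi
      rw [Finset.mem_filter] at hi
      by_cases hEi : E i
      · have := hqlt i hi.1
        rcases hEi with h | h
        · exact Finset.mem_union_left _ (Finset.mem_image.mpr ⟨q i, Finset.mem_range.mpr this, h.symm⟩)
        · exact Finset.mem_union_right _ (Finset.mem_image.mpr ⟨q i, Finset.mem_range.mpr this, h.symm⟩)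
      · simp [hπ', hEi] at hi
    refine (Finset.card_le_card this).trans ((Finset.card_union_le _ _).trans ?_)
    have h1 := Finset.card_image_le (s := Finset.range r) (f := f)
    have h2 := Finset.card_image_le (s := Finset.range r) (f := l)
    rw [Finset.card_range] at h1 h2
    omega

open Classical in
/-- Several stars at once: the members with the same value of `c` form a star. Attached members
have keys that differ by at least `J`. -/
theorem exists_stars_parent {ι γ : Type*} {r J K : ℕ} (hr : 0 < r) (hJ : 0 < J) (I : Finset ι)
    (c : ι → γ) (key w : ι → ℕ) (hw : ∀ i ∈ I, 1 ≤ w i)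
    (hK : ∀ x m, {i ∈ I | c i = x ∧ key i = m}.card ≤ K) :
    ∃ (π : ι → Option ι) (dpt : ι → ℕ),
      (∀ i ∈ I, ∀ j, π i = some j → j ∈ I ∧ c j = c i ∧ key i + J ≤ key j ∧ dpt i = dpt j + 1) ∧
      (∀ i ∈ I, π i = none → dpt i = 1) ∧
      (∀ i ∈ I, r ^ (dpt i - 1) * w i ≤ ∑ j ∈ I with c j = c i, w j) ∧
      (∀ j ∈ I, {i ∈ I | π i = some j}.card ≤ 2 * r) ∧
      ∀ x, {i ∈ I | c i = x ∧ π i = none}.card ≤ 2 * r * (K * J) := by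
  have hidx : ∀ x m, ∃ f : ι → ℕ, (∀ i ∈ I, c i = x → key i = m → f i < K) ∧
      Set.InjOn f {i | i ∈ I ∧ c i = x ∧ key i = m} := by
    intro x m
    set F := {i ∈ I | c i = x ∧ key i = m} with hF
    refine ⟨fun i => if h : i ∈ F then (F.equivFin ⟨i, h⟩ : ℕ) else 0, ?_, ?_⟩
    · intro i hi h1 h2
      have : i ∈ F := by simp [hF, hi, h1, h2]
      simp only [this, dif_pos]
      exact (Fin.is_lt _).trans_le (hK x m)
    · intro i hi j hj hij
      have h1 : i ∈ F := by simpa [hF] using hi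
      have h2 : j ∈ F := by simpa [hF] using hj
      simp only [h1, h2, dif_pos] at hij
      simpa using F.equivFin.injective (Fin.ext hij)
  choose idx hidx1 hidx2 using hidx
  set col : ι → γ × ℕ × ℕ := fun i => (c i, idx (c i) (key i) i, key i % J) with hcol
  set S : γ × ℕ × ℕ → Finset ι := fun t => {i ∈ I | col i = t} with hS
  have hmem : ∀ t i, i ∈ S t ↔ i ∈ I ∧ col i = t := by intro t i; simp [hS]
  have hsub : ∀ t, S t ⊆ I := fun t => Finset.filter_subset _ _
  have hinj : ∀ t, Set.InjOn key (S t) := by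
    intro t i hi j hj hij
    rw [Finset.mem_coe, hmem] at hi hj
    have h := hi.2.trans hj.2.symm
    simp only [hcol, Prod.mk.injEq] at h
    refine hidx2 (c i) (key i) ⟨hi.1, rfl, rfl⟩ ⟨hj.1, h.1.symm, hij.symm⟩ ?_
    rw [h.2.1, h.1, hij]
  have hstar := fun t => exists_star_parent hr key w (S t) (hinj t) fun i hi => hw i (hsub t hi)
  choose π dpt hπ1 hπ2 hπ3 hπ4 hπ5 using hstar
  have hself : ∀ i ∈ I, i ∈ S (col i) := fun i hi => (hmem _ _).mpr ⟨hi, rfl⟩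
  refine ⟨fun i => π (col i) i, fun i => dpt (col i) i, ?_, ?_, ?_, ?_, ?_⟩
  · intro i hi j hj
    obtain ⟨h1, h2, h3⟩ := hπ1 _ i (hself i hi) j hj
    obtain ⟨h4, h5⟩ := (hmem _ _).mp h1
    beta_reduce
    rw [h5]
    simp only [hcol, Prod.mk.injEq] at h5
    refine ⟨h4, h5.1, ?_, h3⟩
    have : key i ≡ key j [MOD J] := h5.2.2.symm
    rw [Nat.modEq_iff_dvd' h2.le] at this
    have := Nat.le_of_dvd (by omega) this
    omega
  · exact fun i hi h => hπ2 _ i (hself i hi) h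
  · intro i hi
    refine (hπ3 _ i (hself i hi)).2.trans (Finset.sum_le_sum_of_subset fun j hj => ?_)
    rw [hmem] at hj
    exact Finset.mem_filter.mpr ⟨hj.1, congrArg Prod.fst hj.2⟩
  · intro j hj
    refine (Finset.card_le_card fun i hi => ?_).trans (hπ4 _ j (hself j hj))
    rw [Finset.mem_filter] at hi ⊢
    have h1 := (hπ1 _ i (hself i hi.1) j hi.2).1
    rw [((hmem _ _).mp h1).2]
    exact ⟨hself i hi.1, hi.2⟩
  · intro x
    have hsub2 : {i ∈ I | c i = x ∧ π (col i) i = none} ⊆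
        (Finset.range K ×ˢ Finset.range J).biUnion fun t =>
          {i ∈ S (x, t) | π (x, t) i = none} := by
      intro i hi
      obtain ⟨hiI, rfl, h⟩ := Finset.mem_filter.mp hi
      refine Finset.mem_biUnion.mpr ⟨(idx (c i) (key i) i, key i % J), ?_, ?_⟩
      · simp only [Finset.mem_product, Finset.mem_range]
        exact ⟨hidx1 _ _ i hiI rfl rfl, Nat.mod_lt _ hJ⟩
      · exact Finset.mem_filter.mpr ⟨hself i hiI, h⟩
    refine (Finset.card_le_card hsub2).trans ((Finset.card_biUnion_le_card_mul _ _ (2 * r)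
      fun t _ => hπ5 _).trans ?_)
    rw [Finset.card_product, Finset.card_range, Finset.card_range, mul_comm]

section Conn

variable {V : Type} [MetricSpace V]

theorem edgeWeight_nonneg (e : Sym2 V) : 0 ≤ edgeWeight e := by
  induction e with
  | _ u v => exact dist_nonneg

/-- `Conn H n L u v`: a walk from `u` to `v` in `H` with at most `n` edges and length at
most `L`. -/
def Conn (H : Finset (Sym2 V)) : ℕ → ℝ → V → V → Prop
  | 0, L, u, v => u = v ∧ 0 ≤ L
  | n + 1, L, u, v => ∃ w, Conn H n (L - dist w v) u w ∧ (w = v ∨ s(w, v) ∈ H)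

namespace Conn

variable {H H' : Finset (Sym2 V)} {m n : ℕ} {L L' : ℝ} {u v w : V}

theorem mono_length (hL : L ≤ L') (h : Conn H n L u v) : Conn H n L' u v := by
  induction n generalizing v L L' with
  | zero => exact ⟨h.1, h.2.trans hL⟩
  | succ n ih =>
    obtain ⟨w, hw, h⟩ := h
    exact ⟨w, ih (by linarith) hw, h⟩

theorem mono_graph (hH : H ⊆ H') (h : Conn H n L u v) : Conn H' n L u v := by
  induction n generalizing v L with
  | zero => exact h
  | succ n ih =>
    obtain ⟨w, hw, h⟩ := h
    exact ⟨w, ih hw, h.imp id fun h => hH h⟩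

theorem refl (n : ℕ) (hL : 0 ≤ L) (u : V) : Conn H n L u u := by
  induction n with
  | zero => exact ⟨rfl, hL⟩
  | succ n ih => exact ⟨u, by simpa using ih, Or.inl rfl⟩

theorem of_mem (h : s(u, v) ∈ H) : Conn H 1 (dist u v) u v :=
  ⟨u, ⟨rfl, by simp⟩, Or.inr h⟩

theorem trans (h : Conn H m L u v) (h' : Conn H n L' v w) : Conn H (m + n) (L + L') u w := by
  induction n generalizing w L' with
  | zero =>
    obtain ⟨rfl, h0⟩ := h'
    exact h.mono_length (by linarith)
  | succ n ih =>
    obtain ⟨x, hx, h'⟩ := h'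
    exact ⟨x, (ih hx).mono_length (by linarith), h'⟩

theorem mono_steps (hmn : m ≤ n) (h : Conn H m L u v) : Conn H n L u v := by
  obtain ⟨k, rfl⟩ := Nat.exists_eq_add_of_le hmn
  simpa using h.trans (refl k le_rfl v)

theorem mono (hmn : m ≤ n) (hL : L ≤ L') (h : Conn H m L u v) : Conn H n L' u v :=
  (h.mono_steps hmn).mono_length hL

theorem symm (h : Conn H n L u v) : Conn H n L v u := by
  induction n generalizing v L with
  | zero => exact ⟨h.1.symm, h.2⟩
  | succ n ih =>
    obtain ⟨w, hw, h⟩ := h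
    have h1 : Conn H 1 (dist v w) v w := by
      rcases h with rfl | h
      · exact refl 1 (by simp) _
      · exact of_mem (Sym2.eq_swap ▸ h)
    have h2 := h1.trans (ih hw)
    rw [dist_comm v w] at h2
    exact h2.mono (by omega) (by linarith)

/-- Loops may be removed, and the walk turned into a path of the frozen form. -/
theorem exists_walk (hH : ∀ e ∈ H, ¬ e.IsDiag → e ∈ H') (h : Conn H n L u v) :
    ∃ k ≤ n, ∃ x : Fin (k + 1) → V, x 0 = u ∧ x (Fin.last k) = v ∧
      (∀ i : Fin k, s(x i.castSucc, x i.succ) ∈ H') ∧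
      ∑ i : Fin k, dist (x i.castSucc) (x i.succ) ≤ L := by
  induction n generalizing v L with
  | zero =>
    obtain ⟨rfl, h0⟩ := h
    exact ⟨0, le_rfl, fun _ => u, rfl, rfl, fun i => i.elim0, by simpa using h0⟩
  | succ n ih =>
    obtain ⟨w, hw, h⟩ := h
    obtain ⟨k, hk, x, hx0, hxl, hx, hsum⟩ := ih hw
    by_cases hwv : w = v
    · subst hwv
      exact ⟨k, by omega, x, hx0, hxl, hx, by simpa using hsum⟩
    · have hmem : s(w, v) ∈ H' := hH _ (h.resolve_left hwv) (by simpa using hwv)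
      refine ⟨k + 1, by omega, Fin.snoc (α := fun _ => V) x v, ?_, by simp, ?_, ?_⟩
      · rw [← hx0]
        exact Fin.snoc_castSucc (α := fun _ => V) v x 0
      · intro i
        refine Fin.lastCases ?_ (fun i => ?_) i
        · rw [Fin.snoc_castSucc, Fin.succ_last, Fin.snoc_last, hxl]
          exact hmem
        · rw [Fin.snoc_castSucc, Fin.succ_castSucc, Fin.snoc_castSucc]
          exact hx i
      · rw [Fin.sum_univ_castSucc]
        simp only [Fin.snoc_castSucc, Fin.succ_castSucc, Fin.succ_last, Fin.snoc_last, hxl]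
        linarith

end Conn

open Classical in
/-- The edges of a family of stars of bounded degree in a metric space. The member `i` with
representative `rep i` is at distance at most `A * (S₀ / 2 ^ key i)` from its center. -/
theorem exists_star_edges {ι γ : Type*} {r J K m₁ m₂ : ℕ} (hr : 0 < r) (hJ : 0 < J)
    (I : Finset ι) (c : ι → γ) (key w : ι → ℕ) (hw : ∀ i ∈ I, 1 ≤ w i)
    (hK : ∀ x m, ∀ F ⊆ I, (∀ i ∈ F, c i = x ∧ key i = m) → F.card ≤ K) (rep : ι → V) (ctr : γ → V)
    (hrep : ∀ p, ∀ F ⊆ I, (∀ i ∈ F, rep i = p) → F.card ≤ m₁)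
    (hctr : ∀ p, ∀ F : Finset γ, (∀ x ∈ F, (∃ i ∈ I, c i = x) ∧ ctr x = p) → F.card ≤ m₂)
    {A S₀ : ℝ} (hA : 0 ≤ A) (hS₀ : 0 ≤ S₀)
    (hdist : ∀ i ∈ I, dist (rep i) (ctr (c i)) ≤ A * (S₀ / 2 ^ key i)) :
    ∃ E : Finset (Sym2 V), E.card ≤ I.card ∧
      (∀ p, {e ∈ E | p ∈ e}.card ≤ m₁ * (1 + 2 * r) + m₂ * (2 * r * (K * J))) ∧
      totalWeight E ≤ ∑ i ∈ I, 2 * A * (S₀ / 2 ^ key i) ∧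
      ∀ i ∈ I, ∃ h, ∃ F ⊆ I, (∀ j ∈ F, c j = c i) ∧ r ^ h * w i ≤ ∑ j ∈ F, w j ∧
        Conn E (h + 1) (dist (rep i) (ctr (c i)) + 4 * A / 2 ^ J * (S₀ / 2 ^ key i))
          (rep i) (ctr (c i)) := by
  obtain ⟨π, dpt, hπ1, hπ2, hπ3, hπ4, hπ5⟩ := exists_stars_parent hr hJ I c key w hw
    fun x m => hK x m _ (Finset.filter_subset _ _) fun i hi => (Finset.mem_filter.mp hi).2
  replace hrep : ∀ p, {i ∈ I | rep i = p}.card ≤ m₁ := fun p =>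
    hrep p _ (Finset.filter_subset _ _) fun i hi => (Finset.mem_filter.mp hi).2
  replace hctr : ∀ p, {x ∈ I.image c | ctr x = p}.card ≤ m₂ := fun p =>
    hctr p _ fun x hx => ⟨Finset.mem_image.mp (Finset.mem_filter.mp hx).1, (Finset.mem_filter.mp hx).2⟩
  have hscale : ∀ {i j}, key i + J ≤ key j → S₀ / 2 ^ key j ≤ S₀ / 2 ^ key i / 2 ^ J := by
    intro i j hij
    rw [div_div, ← pow_add]
    exact div_le_div_of_nonneg_left hS₀ (by positivity) (pow_le_pow_right₀ (by norm_num) hij)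
  have h2J : (2 : ℝ) ≤ 2 ^ J := by
    simpa using pow_le_pow_right₀ (by norm_num : (1 : ℝ) ≤ 2) hJ
  have hnn : ∀ i, 0 ≤ S₀ / 2 ^ key i := fun i => by positivity
  set tgt : ι → V := fun i => (π i).elim (ctr (c i)) rep with htgt
  have htd : ∀ i ∈ I, dist (rep i) (tgt i) ≤ 2 * A * (S₀ / 2 ^ key i) := by
    intro i hi
    have h1 := hdist i hi
    have h2 := mul_nonneg hA (hnn i)
    rcases hp : π i with _ | j
    · simp only [htgt, hp, Option.elim_none]; linarith
    · obtain ⟨h3, h4, h5, -⟩ := hπ1 i hi j hp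
      simp only [htgt, hp, Option.elim_some]
      have h6 := hdist j h3
      rw [h4] at h6
      have h7 := dist_triangle_right (rep i) (rep j) (ctr (c i))
      have h8 := mul_le_mul_of_nonneg_left ((hscale h5).trans (div_le_self (hnn i) (by linarith))) hA
      linarith
  refine ⟨I.image fun i => s(rep i, tgt i), Finset.card_image_le, ?_, ?_, ?_⟩
  · intro p
    have hsub : {e ∈ I.image (fun i => s(rep i, tgt i)) | p ∈ e} ⊆
        ({i ∈ I | rep i = p} ∪ {j ∈ I | rep j = p}.biUnion (fun j => {i ∈ I | π i = some j}) ∪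
          {x ∈ I.image c | ctr x = p}.biUnion (fun x => {i ∈ I | c i = x ∧ π i = none})).image
          fun i => s(rep i, tgt i) := by
      intro e he
      obtain ⟨he, hpe⟩ := Finset.mem_filter.mp he
      obtain ⟨i, hi, rfl⟩ := Finset.mem_image.mp he
      refine Finset.mem_image.mpr ⟨i, ?_, rfl⟩
      simp only [Finset.mem_union, Finset.mem_filter, Finset.mem_biUnion]
      rcases Sym2.mem_iff.mp hpe with h | h
      · exact Or.inl (Or.inl ⟨hi, h.symm⟩)
      · rcases hp : π i with _ | j
        · simp only [htgt, hp, Option.elim_none] at h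
          exact Or.inr ⟨c i, ⟨Finset.mem_image_of_mem _ hi, h.symm⟩, hi, rfl, rfl⟩
        · simp only [htgt, hp, Option.elim_some] at h
          exact Or.inl (Or.inr ⟨j, ⟨(hπ1 i hi j hp).1, h.symm⟩, hi, rfl⟩)
    refine (Finset.card_le_card hsub).trans (Finset.card_image_le.trans ?_)
    refine (Finset.card_union_le _ _).trans ?_
    have h1 := Finset.card_union_le {i ∈ I | rep i = p}
      ({j ∈ I | rep j = p}.biUnion (fun j => {i ∈ I | π i = some j}))
    have h2 := Finset.card_biUnion_le_card_mul {j ∈ I | rep j = p}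
      (fun j => {i ∈ I | π i = some j}) (2 * r) fun j hj => hπ4 j (Finset.mem_filter.mp hj).1
    have h3 := Finset.card_biUnion_le_card_mul {x ∈ I.image c | ctr x = p}
      (fun x => {i ∈ I | c i = x ∧ π i = none}) _ fun x _ => hπ5 x
    have h4 := Nat.mul_le_mul_right (2 * r) (hrep p)
    have h5 := Nat.mul_le_mul_right (2 * r * (K * J)) (hctr p)
    have h6 := hrep p
    rw [mul_add, mul_one]
    omega
  · rw [totalWeight]
    refine (Finset.sum_image_le_of_nonneg ?_).trans (Finset.sum_le_sum htd)
    exact fun e _ => edgeWeight_nonneg e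
  · intro i hi
    refine ⟨dpt i - 1, _, Finset.filter_subset _ _, fun j hj => (Finset.mem_filter.mp hj).2,
      hπ3 i hi, ?_⟩
    have key_claim : ∀ n, ∀ i ∈ I, dpt i = n → 1 ≤ n ∧
        Conn (I.image fun i => s(rep i, tgt i)) n
          (dist (rep i) (ctr (c i)) + 4 * A / 2 ^ J * (S₀ / 2 ^ key i)) (rep i) (ctr (c i)) := by
      intro n
      induction n with
      | zero =>
        intro i hi h0
        rcases hp : π i with _ | j
        · have := hπ2 i hi hp; omega
        · have := (hπ1 i hi j hp).2.2.2; omega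
      | succ n ih =>
        intro i hi hn
        refine ⟨by omega, ?_⟩
        have h0 : 0 ≤ 4 * A / 2 ^ J * (S₀ / 2 ^ key i) := mul_nonneg (by positivity) (hnn i)
        have hmem : s(rep i, tgt i) ∈ I.image fun i => s(rep i, tgt i) :=
          Finset.mem_image_of_mem _ hi
        have hc := Conn.of_mem hmem
        rcases hp : π i with _ | j
        · simp only [htgt, hp, Option.elim_none] at hc
          exact hc.mono (by omega) (by linarith)
        · obtain ⟨h3, h4, h5, h6⟩ := hπ1 i hi j hp
          have hc2 := (ih j h3 (by omega)).2
          simp only [htgt, hp, Option.elim_some] at hc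
          rw [h4] at hc2
          refine (hc.trans hc2).mono (by omega) ?_
          have h7 := dist_triangle_right (rep i) (rep j) (ctr (c i))
          have h8 := hdist j h3
          rw [h4] at h8
          have h9 : A * (S₀ / 2 ^ key j) ≤ A * (S₀ / 2 ^ key i / 2 ^ J) :=
            mul_le_mul_of_nonneg_left (hscale h5) hA
          have h10 : 4 * A / 2 ^ J * (S₀ / 2 ^ key i) = 4 * (A * (S₀ / 2 ^ key i / 2 ^ J)) := by
            ring
          have h11 : 4 * A / 2 ^ J * (S₀ / 2 ^ key j) ≤ 2 * (A * (S₀ / 2 ^ key j)) := by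
            have : 4 * A / 2 ^ J ≤ 2 * A := by
              rw [div_le_iff₀ (by positivity)]; nlinarith
            have := mul_le_mul_of_nonneg_right this (hnn j)
            linarith
          linarith
    obtain ⟨h1, h2⟩ := key_claim _ i hi rfl
    exact h2.mono_steps (by omega)

end Conn

open Classical in
/-- A hierarchy of nested partitions of a finite metric space. The part `Q ℓ x` of level `ℓ`
that contains `x` has diameter at most `S₀ / 2 ^ ℓ`, and balls of radius `R * (S₀ / 2 ^ ℓ)` meet at
most `κ` parts of level `ℓ`. -/
structure Hierarchy (V : Type) [MetricSpace V] [Fintype V] (R κ : ℕ) where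
  /-- The part of level `ℓ` that contains `x`. -/
  Q : ℕ → V → Finset V
  /-- The scale of level zero. -/
  S₀ : ℝ
  /-- A level at which all parts are singletons. -/
  top : ℕ
  S₀_pos : 0 < S₀
  mem_self : ∀ ℓ x, x ∈ Q ℓ x
  eq_of_mem : ∀ {ℓ x y}, y ∈ Q ℓ x → Q ℓ y = Q ℓ x
  succ_subset : ∀ ℓ x, Q (ℓ + 1) x ⊆ Q ℓ x
  zero_eq : ∀ x, Q 0 x = Finset.univ
  top_eq : ∀ x, Q top x = {x}
  dist_le : ∀ {ℓ x y}, y ∈ Q ℓ x → dist x y ≤ S₀ / 2 ^ ℓ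
  pack : ∀ ℓ x, ({y | dist x y ≤ R * (S₀ / 2 ^ ℓ)}.toFinset.image (Q ℓ)).card ≤ κ

namespace Hierarchy

/-- The size class of a set. -/
def cls {V : Type} (r : ℕ) (S : Finset V) : ℕ := Nat.log r S.card

theorem lt_pow_cls {V : Type} {r : ℕ} (hr : 2 ≤ r) (S : Finset V) : S.card < r ^ (cls r S + 1) :=
  Nat.lt_pow_succ_log_self hr _

theorem cls_mono {V : Type} {r : ℕ} {S S' : Finset V} (h : S ⊆ S') : cls r S ≤ cls r S' :=
  Nat.log_mono_right (Finset.card_le_card h)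

variable {V : Type} [MetricSpace V] [Fintype V] {R κ : ℕ} (T : Hierarchy V R κ)

theorem scale_nonneg (ℓ : ℕ) : 0 ≤ T.S₀ / 2 ^ ℓ := by
  have := T.S₀_pos
  positivity

theorem scale_anti {ℓ m : ℕ} (h : ℓ ≤ m) : T.S₀ / 2 ^ m ≤ T.S₀ / 2 ^ ℓ :=
  div_le_div_of_nonneg_left T.S₀_pos.le (by positivity) (pow_le_pow_right₀ (by norm_num) h)

theorem scale_succ (ℓ : ℕ) : T.S₀ / 2 ^ (ℓ + 1) = T.S₀ / 2 ^ ℓ / 2 := by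
  rw [pow_succ, div_div]

theorem anti {ℓ m : ℕ} (h : ℓ ≤ m) (x : V) : T.Q m x ⊆ T.Q ℓ x := by
  induction m, h using Nat.le_induction with
  | base => exact subset_rfl
  | succ m _ ih => exact (T.succ_subset m x).trans ih

theorem eq_singleton {ℓ : ℕ} (h : T.top ≤ ℓ) (x : V) : T.Q ℓ x = {x} := by
  have h1 := T.anti h x
  rw [T.top_eq] at h1
  exact (Finset.subset_singleton_iff.mp h1).resolve_left
    (Finset.nonempty_iff_ne_empty.mp ⟨x, T.mem_self ℓ x⟩)

open Classical in
/-- The parts of all levels. -/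
noncomputable def clusters : Finset (Finset V) := {S | ∃ ℓ x, T.Q ℓ x = S}

variable {S S' : Finset V} {x y : V} {ℓ m : ℕ}

theorem mem_clusters : S ∈ T.clusters ↔ ∃ ℓ x, T.Q ℓ x = S := by
  simp [clusters]

theorem Q_mem (ℓ : ℕ) (x : V) : T.Q ℓ x ∈ T.clusters := T.mem_clusters.mpr ⟨ℓ, x, rfl⟩

theorem exists_level (hS : S ∈ T.clusters) : ∃ ℓ, ∀ x ∈ S, T.Q ℓ x = S := by
  obtain ⟨ℓ, y, rfl⟩ := T.mem_clusters.mp hS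
  exact ⟨ℓ, fun x hx => T.eq_of_mem hx⟩

theorem nonempty_of_mem (hS : S ∈ T.clusters) : S.Nonempty := by
  obtain ⟨ℓ, y, rfl⟩ := T.mem_clusters.mp hS
  exact ⟨y, T.mem_self ℓ y⟩

/-- The first level of a cluster. -/
noncomputable def lev (S : Finset V) : ℕ := sInf {ℓ | ∀ x ∈ S, T.Q ℓ x = S}

theorem Q_lev (hS : S ∈ T.clusters) (hx : x ∈ S) : T.Q (T.lev S) x = S :=
  Nat.sInf_mem (s := {ℓ | ∀ x ∈ S, T.Q ℓ x = S}) (T.exists_level hS) x hx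

theorem lev_le (h : T.Q ℓ x = S) : T.lev S ≤ ℓ :=
  Nat.sInf_le fun y hy => by
    rw [← h] at hy ⊢
    exact T.eq_of_mem hy

theorem Q_eq_of_le (h : T.Q ℓ x = S) (h1 : T.lev S ≤ m) (h2 : m ≤ ℓ) : T.Q m x = S := by
  have hS : S ∈ T.clusters := h ▸ T.Q_mem ℓ x
  have hx : x ∈ S := h ▸ T.mem_self ℓ x
  refine Finset.Subset.antisymm ?_ (h ▸ T.anti h2 x)
  rw [← T.Q_lev hS hx]
  exact T.anti h1 x

theorem laminar (hS : S ∈ T.clusters) (hS' : S' ∈ T.clusters) (hx : x ∈ S) (hx' : x ∈ S') :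
    S ⊆ S' ∨ S' ⊆ S := by
  rw [← T.Q_lev hS hx, ← T.Q_lev hS' hx']
  exact (le_total (T.lev S') (T.lev S)).imp (fun h => T.anti h x) fun h => T.anti h x

/-- A cluster that is strictly contained in `Q ℓ x` lives at a later level. -/
theorem lt_lev (hS : S ∈ T.clusters) (hx : x ∈ S) (h : ¬ T.Q ℓ x ⊆ S) : ℓ < T.lev S := by
  by_contra! hle
  exact h (T.Q_lev hS hx ▸ T.anti hle x)

theorem dist_le_of_mem (hx : x ∈ T.Q ℓ y) {z : V} (hz : z ∈ T.Q ℓ y) :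
    dist x z ≤ T.S₀ / 2 ^ ℓ :=
  T.dist_le (by rwa [T.eq_of_mem hx])

theorem card_clusters_filter_le (ℓ : ℕ) (y : V) (F : Finset (Finset V))
    (h : ∀ S ∈ F, ∃ x, dist y x ≤ R * (T.S₀ / 2 ^ ℓ) ∧ T.Q ℓ x = S) : F.card ≤ κ := by
  classical
  refine (Finset.card_le_card fun S hS => ?_).trans (T.pack ℓ y)
  obtain ⟨x, hx, rfl⟩ := h S hS
  exact Finset.mem_image.mpr ⟨x, by simpa using hx, by congr⟩

/-- Delegates: every cluster chooses one of its points and every point is chosen at most twice. -/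
theorem exists_delegate [Nonempty V] : ∃ D : Finset V → V, (∀ S ∈ T.clusters, D S ∈ S) ∧
    ∀ p, ∀ F ⊆ T.clusters, (∀ S ∈ F, D S = p) → F.card ≤ 2 := by
  classical
  obtain ⟨f, hf⟩ : ∃ f : V → ℕ, Function.Injective f :=
    ⟨fun x => Fintype.equivFin V x, fun x y h => by simpa using Fin.ext h⟩
  have hD : ∀ S, ∃ y, S ∈ T.clusters → y ∈ S ∧ (S = {y} ∨ ((∃ x ∈ S, f x < f y) ∧
      ∀ S' ∈ T.clusters, S' ⊂ S → y ∈ S' → ∀ x ∈ S', f y ≤ f x)) := by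
    intro S
    by_cases hS : S ∈ T.clusters
    swap
    · exact ⟨Classical.arbitrary V, fun h => absurd h hS⟩
    obtain ⟨x₀, hx₀, hmin⟩ := Finset.exists_min_image S f (T.nonempty_of_mem hS)
    by_cases hsing : S = {x₀}
    · exact ⟨x₀, fun _ => ⟨hx₀, Or.inl hsing⟩⟩
    have hex : ∃ ℓ, ¬ S ⊆ T.Q ℓ x₀ := by
      refine ⟨T.top, fun h => hsing ?_⟩
      rw [T.top_eq] at h
      exact (Finset.subset_singleton_iff.mp h).resolve_left
        (Finset.nonempty_iff_ne_empty.mp ⟨x₀, hx₀⟩)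
    obtain ⟨n, hn⟩ : ∃ n, Nat.find hex = n + 1 := by
      refine Nat.exists_eq_succ_of_ne_zero fun h => ?_
      have := Nat.find_spec hex
      rw [h, T.zero_eq] at this
      exact this (Finset.subset_univ S)
    have hn1 := Nat.find_spec hex
    have hn2 := Nat.find_min hex (m := n) (by omega)
    rw [hn] at hn1
    rw [not_not] at hn2
    obtain ⟨z, hzS, hz⟩ := Finset.not_subset.mp hn1
    have hSn : T.Q n x₀ = S := by
      refine Finset.Subset.antisymm ?_ hn2
      by_cases h : n + 1 ≤ T.lev S
      · exact absurd (T.Q_lev hS hx₀ ▸ T.anti h x₀) hn1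
      · conv_rhs => rw [← T.Q_lev hS hx₀]
        exact T.anti (by omega) x₀
    obtain ⟨y, hy, hymin⟩ := Finset.exists_min_image (T.Q (n + 1) z) f ⟨z, T.mem_self _ z⟩
    have hSz : T.Q n z = S := hSn ▸ T.eq_of_mem (hSn.symm ▸ hzS)
    have hyS : y ∈ S := hSz ▸ T.succ_subset n z hy
    have hSy : T.Q n y = S := hSn ▸ T.eq_of_mem (hSn.symm ▸ hyS)
    refine ⟨y, fun _ => ⟨hyS, Or.inr ⟨⟨x₀, hx₀, lt_of_le_of_ne (hmin y hyS) fun h => hz ?_⟩, ?_⟩⟩⟩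
    · rw [hf h, T.eq_of_mem hy]
      exact T.mem_self _ z
    · intro S' hS' hlt hyS' x hx
      have h1 := T.lt_lev hS' hyS' (hSy ▸ hlt.2)
      rw [← T.Q_lev hS' hyS'] at hx
      have h2 := T.anti h1 y hx
      rw [T.eq_of_mem hy] at h2
      exact hymin x h2
  choose D hD using hD
  refine ⟨D, fun S hS => (hD S hS).1, fun p F hF hp => ?_⟩
  have h1 : (F.erase {p}).card ≤ 1 := by
    rw [Finset.card_le_one]
    have key : ∀ S ∈ F.erase {p}, ∀ S' ∈ F.erase {p}, ¬ S ⊂ S' := by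
      intro S hS S' hS' hlt
      obtain ⟨hSp, hS⟩ := Finset.mem_erase.mp hS
      obtain ⟨hSp', hS'⟩ := Finset.mem_erase.mp hS'
      obtain ⟨h2, h3⟩ := hD S (hF hS)
      obtain ⟨h4, h5⟩ := hD S' (hF hS')
      rw [hp S hS] at h2 h3
      rw [hp S' hS'] at h4 h5
      obtain ⟨x, hx, hlt'⟩ := (h3.resolve_left hSp).1
      exact absurd ((h5.resolve_left hSp').2 S (hF hS) hlt h2 x hx) (by omega)
    intro S hS S' hS'
    by_contra hne
    have h2 := (hD S (hF (Finset.mem_of_mem_erase hS))).1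
    have h3 := (hD S' (hF (Finset.mem_of_mem_erase hS'))).1
    rw [hp S (Finset.mem_of_mem_erase hS)] at h2
    rw [hp S' (Finset.mem_of_mem_erase hS')] at h3
    rcases T.laminar (hF (Finset.mem_of_mem_erase hS)) (hF (Finset.mem_of_mem_erase hS')) h2 h3
      with h | h
    · exact key S hS S' hS' (h.ssubset_of_ne hne)
    · exact key S' hS' S hS (h.ssubset_of_ne (Ne.symm hne))
  have := Finset.pred_card_le_card_erase (s := F) (a := {p})
  omega

theorem card_clusters_le [Nonempty V] : T.clusters.card ≤ 2 * Fintype.card V := by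
  classical
  obtain ⟨D, hD, hD2⟩ := T.exists_delegate
  refine (Finset.card_le_mul_card_image (f := D) T.clusters 2 fun p _ =>
    hD2 p _ (Finset.filter_subset _ _) fun S hS => (Finset.mem_filter.mp hS).2).trans ?_
  exact Nat.mul_le_mul_left 2 (Finset.card_le_univ _)

theorem pow_cls_le {r : ℕ} (hS : S ∈ T.clusters) : r ^ cls r S ≤ S.card :=
  Nat.pow_log_le_self r (Finset.card_ne_zero.mpr (T.nonempty_of_mem hS))

/-- The minimal clusters with at least `m` points. -/
noncomputable def minimalClusters (m : ℕ) : Finset (Finset V) := by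
  classical
  exact {S ∈ T.clusters | m ≤ S.card ∧ ∀ S' ∈ T.clusters, S' ⊂ S → S'.card < m}

theorem mem_minimalClusters : S ∈ T.minimalClusters m ↔
    S ∈ T.clusters ∧ m ≤ S.card ∧ ∀ S' ∈ T.clusters, S' ⊂ S → S'.card < m := by
  simp [minimalClusters]

theorem disjoint_minimalClusters (hS : S ∈ T.minimalClusters m) (hS' : S' ∈ T.minimalClusters m)
    (hne : S ≠ S') : Disjoint S S' := by
  rw [mem_minimalClusters] at hS hS'
  rw [Finset.disjoint_left]
  intro x hx hx'
  rcases T.laminar hS.1 hS'.1 hx hx' with h | h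
  · have := hS'.2.2 S hS.1 (h.ssubset_of_ne hne); omega
  · have := hS.2.2 S' hS'.1 (h.ssubset_of_ne hne.symm); omega

theorem exists_minimalCluster_subset (hS : S ∈ T.clusters) (hm : m ≤ S.card) :
    ∃ S' ∈ T.minimalClusters m, S' ⊆ S := by
  induction hn : S.card using Nat.strong_induction_on generalizing S with
  | _ n ih =>
  by_cases h : ∀ S' ∈ T.clusters, S' ⊂ S → S'.card < m
  · exact ⟨S, T.mem_minimalClusters.mpr ⟨hS, hm, h⟩, subset_rfl⟩
  · push Not at h
    obtain ⟨S', hS', hlt, hm'⟩ := h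
    obtain ⟨S'', h1, h2⟩ := ih _ (hn ▸ Finset.card_lt_card hlt) hS' hm' rfl
    exact ⟨S'', h1, h2.trans hlt.1⟩

theorem card_mul_le_of_minimalClusters {F : Finset (Finset V)} (hF : F ⊆ T.minimalClusters m)
    {U : Finset V} (hU : ∀ S ∈ F, S ⊆ U) : F.card * m ≤ U.card := by
  classical
  have h1 : (F.biUnion id).card = ∑ S ∈ F, S.card :=
    Finset.card_biUnion fun S hS S' hS' hne => T.disjoint_minimalClusters (hF hS) (hF hS') hne
  have h2 : F.biUnion id ⊆ U := Finset.biUnion_subset.mpr hU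
  have h3 : F.card * m ≤ ∑ S ∈ F, S.card := by
    rw [← smul_eq_mul]
    exact Finset.card_nsmul_le_sum _ _ _ fun S hS => (T.mem_minimalClusters.mp (hF hS)).2.1
  have := Finset.card_le_card h2
  omega

/-- Distinct representatives of the minimal clusters of all positive size classes. -/
theorem exists_representatives [Nonempty V] {r : ℕ} (hr : 2 ≤ r) : ∃ G : ℕ → Finset V → V,
    (∀ s ≥ 1, ∀ S ∈ T.minimalClusters (r ^ s), G s S ∈ S) ∧
    ∀ s ≥ 1, ∀ S ∈ T.minimalClusters (r ^ s), ∀ t ≥ 1, ∀ S' ∈ T.minimalClusters (r ^ t),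
      G s S = G t S' → s = t ∧ S = S' := by
  classical
  set ι := {p : ℕ × Finset V // 1 ≤ p.1 ∧ p.2 ∈ T.minimalClusters (r ^ p.1)} with hι
  have hall : ∀ X : Finset ι, X.card ≤ (X.biUnion fun i => i.1.2).card := by
    intro X
    set U := X.biUnion fun i => i.1.2 with hU
    set N := X.sup (fun i => i.1.1) + 1 with hN
    have h1 : X.card = ∑ s ∈ (Finset.range N).erase 0, {i ∈ X | i.1.1 = s}.card := by
      refine Finset.card_eq_sum_card_fiberwise fun i hi => ?_
      have h2 : i.1.1 ≤ X.sup (fun i => i.1.1) := Finset.le_sup (f := fun i : ι => i.1.1) hi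
      have h3 := i.2.1
      simp only [Finset.coe_erase, Finset.coe_range, Set.mem_sdiff, Set.mem_Iio,
        Set.mem_singleton_iff]
      omega
    have h2 : ∀ s, {i ∈ X | i.1.1 = s}.card * r ^ s ≤ U.card := by
      intro s
      have h3 : {i ∈ X | i.1.1 = s}.card = ({i ∈ X | i.1.1 = s}.image fun i => i.1.2).card := by
        refine (Finset.card_image_of_injOn fun i hi j hj hij => ?_).symm
        rw [Finset.mem_coe, Finset.mem_filter] at hi hj
        exact Subtype.ext (Prod.ext (hi.2.trans hj.2.symm) hij)
      rw [h3]
      apply T.card_mul_le_of_minimalClusters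
      · intro S hS
        obtain ⟨i, hi, rfl⟩ := Finset.mem_image.mp hS
        obtain ⟨-, rfl⟩ := Finset.mem_filter.mp hi
        exact i.2.2
      · intro S hS
        obtain ⟨i, hi, rfl⟩ := Finset.mem_image.mp hS
        exact Finset.subset_biUnion_of_mem (fun i : ι => i.1.2) (Finset.mem_filter.mp hi).1
    have h3 : ∀ s, ({i ∈ X | i.1.1 = s}.card : ℝ) ≤ U.card * (1 / 2) ^ s := by
      intro s
      have h4 : (2 : ℝ) ^ s ≤ r ^ s := by gcongr; exact_mod_cast hr
      have h5 : ({i ∈ X | i.1.1 = s}.card : ℝ) * r ^ s ≤ U.card := by exact_mod_cast h2 s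
      rw [one_div, inv_pow, ← div_eq_mul_inv, le_div_iff₀ (by positivity)]
      exact (mul_le_mul_of_nonneg_left h4 (by positivity)).trans h5
    have h4 : ∑ s ∈ (Finset.range N).erase 0, ((1 : ℝ) / 2) ^ s ≤ 1 := by
      have h5 := Finset.add_sum_erase (Finset.range N) (fun s => ((1 : ℝ) / 2) ^ s)
        (Finset.mem_range.mpr (show 0 < N by omega))
      have h6 := sum_geometric_two_le N
      simp only [pow_zero] at h5
      linarith
    have h5 : (X.card : ℝ) ≤ U.card := by
      rw [h1]
      push_cast
      calc _ ≤ ∑ s ∈ (Finset.range N).erase 0, (U.card : ℝ) * (1 / 2) ^ s :=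
            Finset.sum_le_sum fun s _ => h3 s
        _ = U.card * ∑ s ∈ (Finset.range N).erase 0, ((1 : ℝ) / 2) ^ s := by rw [Finset.mul_sum]
        _ ≤ U.card * 1 := mul_le_mul_of_nonneg_left h4 (by positivity)
        _ = _ := mul_one _
    exact_mod_cast h5
  obtain ⟨f, hf, hf'⟩ := (Finset.all_card_le_biUnion_card_iff_exists_injective
    (fun i : ι => i.1.2)).mp hall
  refine ⟨fun s S => if h : 1 ≤ s ∧ S ∈ T.minimalClusters (r ^ s) then f ⟨(s, S), h⟩
    else Classical.arbitrary V, ?_, ?_⟩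
  · intro s hs S hS
    beta_reduce
    rw [dif_pos ⟨hs, hS⟩]
    exact hf' _
  · intro s hs S hS t ht S' hS' h
    beta_reduce at h
    rw [dif_pos ⟨hs, hS⟩, dif_pos ⟨ht, hS'⟩] at h
    exact Prod.ext_iff.mp (congrArg Subtype.val (hf h))

/-- Hubs `H S` and delegates `D S` of the clusters of a hierarchy. Clusters of size class `s`
choose their hub among the candidates `Z s`, according to the rank `rk`. -/
structure HubSystem (r : ℕ) where
  /-- The candidates for hubs of clusters of a given size class. -/
  Z : ℕ → Finset V
  /-- The hub of a cluster. -/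
  H : Finset V → V
  /-- The delegate of a cluster. -/
  D : Finset V → V
  /-- An injective rank. -/
  rk : V → ℕ
  rk_inj : Function.Injective rk
  H_mem : ∀ {S}, S ∈ T.clusters → H S ∈ S
  H_mem_Z : ∀ {S}, S ∈ T.clusters → H S ∈ Z (cls r S)
  rk_H_le : ∀ {S}, S ∈ T.clusters → ∀ {z}, z ∈ Z (cls r S) → z ∈ S → rk (H S) ≤ rk z
  card_Z_le : ∀ {S}, S ∈ T.clusters → ∀ {F}, F ⊆ Z (cls r S) → F ⊆ S → F.card ≤ r
  Z_unique : ∀ {s t x}, 1 ≤ s → 1 ≤ t → x ∈ Z s → x ∈ Z t → s = t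
  D_mem : ∀ {S}, S ∈ T.clusters → D S ∈ S
  D_fiber : ∀ p, ∀ F ⊆ T.clusters, (∀ S ∈ F, D S = p) → F.card ≤ 2

theorem exists_hubSystem [Nonempty V] {r : ℕ} (hr : 2 ≤ r) : Nonempty (T.HubSystem r) := by
  classical
  obtain ⟨D, hD1, hD2⟩ := T.exists_delegate
  obtain ⟨G, hG1, hG2⟩ := T.exists_representatives hr
  obtain ⟨f, hf⟩ : ∃ f : V → ℕ, Function.Injective f :=
    ⟨fun x => Fintype.equivFin V x, fun x y h => by simpa using Fin.ext h⟩
  set Z : ℕ → Finset V := fun s =>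
    if s = 0 then Finset.univ else (T.minimalClusters (r ^ s)).image (G s) with hZ
  have hZ0 : ∀ x, x ∈ Z 0 := by simp [hZ]
  have hZs : ∀ {s x}, 1 ≤ s → (x ∈ Z s ↔ ∃ S ∈ T.minimalClusters (r ^ s), G s S = x) := by
    intro s x hs
    have : s ≠ 0 := by omega
    simp [hZ, this]
  have hne : ∀ S ∈ T.clusters, ∃ z ∈ S, z ∈ Z (cls r S) := by
    intro S hS
    rcases Nat.eq_zero_or_pos (cls r S) with h | h
    · obtain ⟨x, hx⟩ := T.nonempty_of_mem hS
      exact ⟨x, hx, h ▸ hZ0 x⟩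
    · obtain ⟨S', h1, h2⟩ := T.exists_minimalCluster_subset hS (T.pow_cls_le (r := r) hS)
      exact ⟨G _ S', h2 (hG1 _ h S' h1), (hZs h).mpr ⟨S', h1, rfl⟩⟩
  have hH : ∀ S, ∃ y, S ∈ T.clusters → y ∈ S ∧ y ∈ Z (cls r S) ∧
      ∀ z ∈ Z (cls r S), z ∈ S → f y ≤ f z := by
    intro S
    by_cases hS : S ∈ T.clusters
    swap
    · exact ⟨Classical.arbitrary V, fun h => absurd h hS⟩
    obtain ⟨z, hz, hz'⟩ := hne S hS
    obtain ⟨y, hy, hmin⟩ := Finset.exists_min_image (S ∩ Z (cls r S)) f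
      ⟨z, Finset.mem_inter.mpr ⟨hz, hz'⟩⟩
    rw [Finset.mem_inter] at hy
    exact ⟨y, fun _ => ⟨hy.1, hy.2, fun z h1 h2 => hmin z (Finset.mem_inter.mpr ⟨h2, h1⟩)⟩⟩
  choose H hH using hH
  refine ⟨⟨Z, H, D, f, hf, fun hS => (hH _ hS).1, fun hS => (hH _ hS).2.1,
    fun hS => (hH _ hS).2.2 _, ?_, ?_, fun hS => hD1 _ hS, hD2⟩⟩
  · intro S hS F hFZ hFS
    have hlt := lt_pow_cls hr S
    rcases Nat.eq_zero_or_pos (cls r S) with h | h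
    · rw [h] at hlt
      have := Finset.card_le_card hFS
      simp only [zero_add, pow_one] at hlt
      omega
    · set s := cls r S with hs
      set B := {S' ∈ T.minimalClusters (r ^ s) | S' ⊆ S} with hB
      have h1 : F ⊆ B.image (G s) := by
        intro x hx
        obtain ⟨S', h1, rfl⟩ := (hZs h).mp (hFZ hx)
        refine Finset.mem_image.mpr ⟨S', Finset.mem_filter.mpr ⟨h1, ?_⟩, rfl⟩
        have h2 := T.mem_minimalClusters.mp h1
        rcases T.laminar h2.1 hS (hG1 s h S' h1) (hFS hx) with h3 | h3
        · exact h3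
        · by_cases h4 : S = S'
          · exact h4.symm.subset
          · have h5 := h2.2.2 S hS (h3.ssubset_of_ne h4)
            have h6 : r ^ s ≤ S.card := T.pow_cls_le hS
            omega
      have h2 := T.card_mul_le_of_minimalClusters (F := B) (Finset.filter_subset _ _)
        (U := S) fun S' hS' => (Finset.mem_filter.mp hS').2
      have h3 := (Finset.card_le_card h1).trans Finset.card_image_le
      have h4 : B.card * r ^ s < r * r ^ s := by rw [← pow_succ']; omega
      have := lt_of_mul_lt_mul_right h4 (Nat.zero_le _)
      omega
  · intro s t x hs ht hxs hxt
    obtain ⟨S, h1, h2⟩ := (hZs hs).mp hxs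
    obtain ⟨S', h3, h4⟩ := (hZs ht).mp hxt
    exact (hG2 s hs S h1 t ht S' h3 (h2.trans h4.symm)).1

end Hierarchy

section totalWeight

variable {V : Type} [MetricSpace V]

theorem totalWeight_mono {E E' : Finset (Sym2 V)} (h : E ⊆ E') : totalWeight E ≤ totalWeight E' :=
  Finset.sum_le_sum_of_subset_of_nonneg h fun e _ _ => edgeWeight_nonneg e

open Classical in
theorem totalWeight_biUnion_le {ι : Type*} (I : Finset ι) (E : ι → Finset (Sym2 V)) :
    totalWeight (I.biUnion E) ≤ ∑ i ∈ I, totalWeight (E i) := by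
  induction I using Finset.induction_on with
  | empty => simp [totalWeight]
  | insert i I hi ih =>
    rw [Finset.biUnion_insert, Finset.sum_insert hi]
    refine le_trans ?_ (add_le_add_right ih _)
    have h := Finset.sum_union_inter (s₁ := E i) (s₂ := I.biUnion E) (f := edgeWeight)
    have h2 : 0 ≤ ∑ e ∈ E i ∩ I.biUnion E, edgeWeight e :=
      Finset.sum_nonneg fun e _ => edgeWeight_nonneg e
    simp only [totalWeight]
    linarith

open Classical in
theorem totalWeight_union_le (E E' : Finset (Sym2 V)) :
    totalWeight (E ∪ E') ≤ totalWeight E + totalWeight E' := by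
  have h := Finset.sum_union_inter (s₁ := E) (s₂ := E') (f := edgeWeight)
  have h2 : 0 ≤ ∑ e ∈ E ∩ E', edgeWeight e := Finset.sum_nonneg fun e _ => edgeWeight_nonneg e
  simp only [totalWeight]
  linarith

end totalWeight

namespace Hierarchy

variable {V : Type} [MetricSpace V] [Fintype V] {R κ : ℕ} {T : Hierarchy V R κ} {r : ℕ}

namespace HubSystem

variable (h : T.HubSystem r) {S S' : Finset V} {u v w x : V} {s : ℕ}

theorem H_eq_of_subset (hS : S ∈ T.clusters) (hS' : S' ∈ T.clusters) (hcls : cls r S = cls r S')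
    (hsub : S ⊆ S') (hH : h.H S' ∈ S) : h.H S = h.H S' :=
  h.rk_inj (le_antisymm (h.rk_H_le hS (hcls ▸ h.H_mem_Z hS') hH)
    (h.rk_H_le hS' (hcls ▸ h.H_mem_Z hS) (hsub (h.H_mem hS))))

open Classical in
/-- A point is a candidate in at most two size classes. -/
theorem card_classes_le (p : V) (F : Finset ℕ) (hF : ∀ s ∈ F, p ∈ h.Z s) : F.card ≤ 2 := by
  have h1 : (F.erase 0).card ≤ 1 := by
    rw [Finset.card_le_one]
    intro s hs t ht
    rw [Finset.mem_erase] at hs ht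
    exact h.Z_unique (by omega) (by omega) (hF s hs.2) (hF t ht.2)
  have := Finset.pred_card_le_card_erase (s := F) (a := 0)
  omega

open Classical in
/-- The hubs of size class `s`. -/
noncomputable def hubs (s : ℕ) : Finset V := {S ∈ T.clusters | cls r S = s}.image h.H

open Classical in
/-- The hubs of clusters of size class `s` that contain `u`. -/
noncomputable def above (s : ℕ) (u : V) : Finset V :=
  {S ∈ T.clusters | cls r S = s ∧ u ∈ S}.image h.H

theorem mem_hubs : u ∈ h.hubs s ↔ ∃ S ∈ T.clusters, cls r S = s ∧ h.H S = u := by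
  simp [hubs, and_assoc]

theorem mem_above : v ∈ h.above s u ↔ ∃ S ∈ T.clusters, cls r S = s ∧ u ∈ S ∧ h.H S = v := by
  simp [above, and_assoc]

theorem hubs_subset_Z (s : ℕ) : h.hubs s ⊆ h.Z s := by
  intro u hu
  obtain ⟨S, hS, rfl, rfl⟩ := h.mem_hubs.mp hu
  exact h.H_mem_Z hS

theorem above_subset (s : ℕ) (u : V) : h.above s u ⊆ h.hubs s := by
  intro v hv
  obtain ⟨S, hS, hs, -, rfl⟩ := h.mem_above.mp hv
  exact h.mem_hubs.mpr ⟨S, hS, hs, rfl⟩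

/-- The largest cluster of size class `s` that contains a given point. -/
theorem exists_largest (hS : S ∈ T.clusters) (hu : u ∈ S) : ∃ M ∈ T.clusters,
    cls r M = cls r S ∧ u ∈ M ∧ ∀ S' ∈ T.clusters, cls r S' = cls r S → u ∈ S' → S' ⊆ M := by
  classical
  obtain ⟨M, hM, hmax⟩ := Finset.exists_max_image {S' ∈ T.clusters | cls r S' = cls r S ∧ u ∈ S'}
    Finset.card ⟨S, by simp [hS, hu]⟩
  rw [Finset.mem_filter] at hM
  refine ⟨M, hM.1, hM.2.1, hM.2.2, fun S' hS' h1 h2 => ?_⟩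
  rcases T.laminar hS' hM.1 h2 hM.2.2 with h3 | h3
  · exact h3
  · exact (Finset.eq_of_subset_of_card_le h3 (hmax S' (by simp [hS', h1, h2]))).symm.subset

theorem above_anti (hu : u ∈ h.hubs s) (hv : v ∈ h.above s u) (hu' : u ∈ h.above s v) : u = v := by
  have hv' := h.hubs_subset_Z s (h.above_subset s u hv)
  have huZ := h.hubs_subset_Z s hu
  obtain ⟨S, hS, hs, h1, rfl⟩ := h.mem_above.mp hv
  obtain ⟨S', hS', hs', h1', rfl⟩ := h.mem_above.mp hu'
  exact h.rk_inj (le_antisymm (h.rk_H_le hS' (hs'.symm ▸ hv') h1')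
    (h.rk_H_le hS (hs.symm ▸ huZ) h1))

theorem above_trans (hv : v ∈ h.above s u) : h.above s v ⊆ h.above s u := by
  intro w hw
  obtain ⟨S, hS, hs, h1, rfl⟩ := h.mem_above.mp hv
  obtain ⟨S', hS', hs', h1', rfl⟩ := h.mem_above.mp hw
  rcases T.laminar hS hS' (h.H_mem hS) h1' with h2 | h2
  · exact h.mem_above.mpr ⟨S', hS', hs', h2 h1, rfl⟩
  · rw [h.H_eq_of_subset hS' hS (hs'.trans hs.symm) h2 h1']
    exact hv

theorem card_above_le (s : ℕ) (u : V) : (h.above s u).card ≤ r := by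
  rcases (h.above s u).eq_empty_or_nonempty with h0 | ⟨v, hv⟩
  · simp [h0]
  obtain ⟨S, hS, hs, hu, -⟩ := h.mem_above.mp hv
  obtain ⟨M, hM, hMs, -, hmax⟩ := exists_largest (r := r) hS hu
  refine h.card_Z_le hM ?_ ?_
  · rw [hMs, hs]
    exact (h.above_subset s u).trans (h.hubs_subset_Z s)
  · intro w hw
    obtain ⟨N, hN, hNs, hNu, rfl⟩ := h.mem_above.mp hw
    exact hmax N hN (hNs.trans hs.symm) hNu (h.H_mem hN)

/-- The shortcut edges between the hubs of one size class. -/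
theorem exists_class_edges {k : ℕ} (hk : r ≤ ack k k) (s : ℕ) : ∃ E : Finset (V × V),
    E.card ≤ 22 * (h.hubs s).card ∧ (∀ e ∈ E, e.1 ∈ h.hubs s ∧ e.2 ∈ h.above s e.1) ∧
    (∀ u ∈ h.hubs s, ∀ v ∈ h.above s u, Reach E (2 * k + 5) u v) ∧
    ∀ u ∈ h.hubs s, ∀ v ∈ h.above s u, h.above s v = {v} → (u, v) ∈ E := by
  refine exists_shortcut (fun u _ => h.above_subset s u) ?_ (fun u _ v hv => h.above_trans hv) ?_
    (fun u hu v hv hv' => h.above_anti hu hv hv') fun u _ => (h.card_above_le s u).trans hk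
  · intro u hu
    obtain ⟨S, hS, hs, rfl⟩ := h.mem_hubs.mp hu
    exact h.mem_above.mpr ⟨S, hS, hs, h.H_mem hS, rfl⟩
  · intro u _ v hv w hw
    obtain ⟨S, hS, hs, h1, rfl⟩ := h.mem_above.mp hv
    obtain ⟨N, hN, hNs, hNu, rfl⟩ := h.mem_above.mp hw
    rcases T.laminar hS hN h1 hNu with h2 | h2
    · exact Or.inr (h.mem_above.mpr ⟨N, hN, hNs, h2 (h.H_mem hS), rfl⟩)
    · exact Or.inl (h.mem_above.mpr ⟨S, hS, hs, h2 (h.H_mem hN), rfl⟩)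

/-- Shortcut walks within a size class are short. -/
theorem conn_of_reach {E : Finset (V × V)} {G : Finset (Sym2 V)}
    (hE : ∀ e ∈ E, e.1 ∈ h.hubs s ∧ e.2 ∈ h.above s e.1) (hG : ∀ e ∈ E, s(e.1, e.2) ∈ G)
    {n ℓ : ℕ} (hu : u ∈ h.hubs s) (hcls : cls r (T.Q ℓ u) = s)
    (hR : Reach E n u (h.H (T.Q ℓ u))) :
    Conn G n (2 * (T.S₀ / 2 ^ ℓ)) u (h.H (T.Q ℓ u)) := by
  have habove : ∀ n w, Reach E n u w → w ∈ h.above s u := by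
    intro n
    induction n with
    | zero =>
      rintro w rfl
      obtain ⟨S, hS, hs, rfl⟩ := h.mem_hubs.mp hu
      exact h.mem_above.mpr ⟨S, hS, hs, h.H_mem hS, rfl⟩
    | succ n ih =>
      rintro w ⟨w', hw', rfl | hw⟩
      · exact ih _ hw'
      · exact h.above_trans (ih _ hw') (hE _ hw).2
  induction n generalizing ℓ with
  | zero => exact ⟨hR, mul_nonneg zero_le_two (T.scale_nonneg ℓ)⟩
  | succ n ih =>
    obtain ⟨w, hw, hwv⟩ := hR
    by_cases hne : w = h.H (T.Q ℓ u)
    · exact (ih hcls (hne ▸ hw)).mono_steps (Nat.le_succ n)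
    have hmem := hwv.resolve_left hne
    obtain ⟨S, hS, hs, huS, rfl⟩ := h.mem_above.mp (habove n w hw)
    have hQ := T.Q_mem ℓ u
    have hnot : ¬ T.Q ℓ u ⊆ S := by
      intro hsub
      refine hne (h.above_anti (hE _ hmem).1 (hE _ hmem).2 ?_)
      exact h.mem_above.mpr ⟨S, hS, hs, hsub (h.H_mem hQ), rfl⟩
    have hlt := T.lt_lev hS huS hnot
    have hQS := T.Q_lev hS huS
    have h1 := ih (ℓ := T.lev S) (by rw [hQS, hs]) (by rw [hQS]; exact hw)
    rw [hQS] at h1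
    have hsub : S ⊆ T.Q ℓ u := hQS ▸ T.anti hlt.le u
    have h2 : dist (h.H S) (h.H (T.Q ℓ u)) ≤ T.S₀ / 2 ^ ℓ :=
      T.dist_le_of_mem (hsub (h.H_mem hS)) (h.H_mem hQ)
    have h3 := T.scale_anti (show ℓ + 1 ≤ T.lev S from hlt)
    rw [T.scale_succ] at h3
    exact ⟨h.H S, h1.mono_length (by linarith), Or.inr (hG _ hmem)⟩

end HubSystem

end Hierarchy

namespace Hierarchy

variable {V : Type} [MetricSpace V] [Fintype V] {R κ : ℕ} {T : Hierarchy V R κ} {r : ℕ}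

namespace HubSystem

variable (h : T.HubSystem r)

open Classical in
/-- The union of the shortcut edges of all size classes. -/
theorem exists_hub_graph {k : ℕ} (hk : r ≤ ack k k) : ∃ G : Finset (Sym2 V),
    G.card ≤ 44 * Fintype.card V ∧ (∀ p, {e ∈ G | p ∈ e}.card ≤ 2 * r) ∧
    totalWeight G ≤ r ^ 2 * ∑ S ∈ T.clusters, T.S₀ / 2 ^ T.lev S ∧
    (∀ s u ℓ, u ∈ h.hubs s → cls r (T.Q ℓ u) = s →
      Conn G (2 * k + 5) (2 * (T.S₀ / 2 ^ ℓ)) u (h.H (T.Q ℓ u))) ∧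
    ∀ s u v, u ∈ h.hubs s → v ∈ h.above s u → h.above s v = {v} → s(u, v) ∈ G := by
  choose E hE1 hE2 hE3 hE4 using h.exists_class_edges hk
  set L := T.clusters.image (cls r) with hL
  have hmemL : ∀ {s u}, u ∈ h.hubs s → s ∈ L := by
    intro s u hu
    obtain ⟨S, hS, rfl, -⟩ := h.mem_hubs.mp hu
    exact Finset.mem_image_of_mem _ hS
  set G := L.biUnion fun s => (E s).image fun e => s(e.1, e.2) with hG
  have hmemG : ∀ s, ∀ e ∈ E s, s(e.1, e.2) ∈ G := fun s e he =>
    Finset.mem_biUnion.mpr ⟨s, hmemL (hE2 s e he).1, Finset.mem_image_of_mem _ he⟩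
  have hcommon : ∀ s, ∀ e ∈ E s, ∃ S ∈ T.clusters, cls r S = s ∧ e.1 ∈ S ∧ e.2 ∈ S ∧
      e.1 ∈ h.Z s ∧ e.2 ∈ h.Z s := by
    intro s e he
    obtain ⟨h1, h2⟩ := hE2 s e he
    have h3 := h.hubs_subset_Z s (h.above_subset s _ h2)
    obtain ⟨S, hS, hs, h4, h5⟩ := h.mem_above.mp h2
    exact ⟨S, hS, hs, h4, h5 ▸ h.H_mem hS, h.hubs_subset_Z s h1, h3⟩
  refine ⟨G, ?_, ?_, ?_, ?_, ?_⟩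
  · have h1 : ∑ s ∈ L, (h.hubs s).card ≤ 2 * Fintype.card V := by
      have h2 : ∑ s ∈ L.erase 0, (h.hubs s).card ≤ Fintype.card V := by
        rw [← Finset.card_biUnion]
        · exact Finset.card_le_univ _
        · intro s hs t ht hne
          rw [Function.onFun, Finset.disjoint_left]
          intro x hx hx'
          have := Finset.ne_of_mem_erase hs
          have := Finset.ne_of_mem_erase ht
          exact hne (h.Z_unique (by omega) (by omega) (h.hubs_subset_Z s hx) (h.hubs_subset_Z t hx'))
      have h3 : (h.hubs 0).card ≤ Fintype.card V := Finset.card_le_univ _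
      by_cases h0 : 0 ∈ L
      · rw [← Finset.add_sum_erase L _ h0]
        omega
      · rw [Finset.erase_eq_of_notMem h0] at h2
        omega
    calc G.card ≤ ∑ s ∈ L, ((E s).image fun e => s(e.1, e.2)).card := Finset.card_biUnion_le
      _ ≤ ∑ s ∈ L, 22 * (h.hubs s).card :=
          Finset.sum_le_sum fun s _ => Finset.card_image_le.trans (hE1 s)
      _ = 22 * ∑ s ∈ L, (h.hubs s).card := by rw [Finset.mul_sum]
      _ ≤ _ := by omega
  · intro p
    set B : ℕ → Finset V := fun s =>
      {o ∈ h.Z s | ∃ S ∈ T.clusters, cls r S = s ∧ p ∈ S ∧ o ∈ S} with hB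
    have hBcard : ∀ s, (B s).card ≤ r := by
      intro s
      rcases (B s).eq_empty_or_nonempty with h0 | ⟨o, ho⟩
      · simp [h0]
      obtain ⟨-, S, hS, rfl, hp, -⟩ := Finset.mem_filter.mp ho
      obtain ⟨M, hM, hMs, -, hmax⟩ := exists_largest (r := r) hS hp
      refine h.card_Z_le hM (hMs ▸ Finset.filter_subset _ _) fun o ho => ?_
      obtain ⟨-, S', hS', hs', hp', ho'⟩ := Finset.mem_filter.mp ho
      exact hmax S' hS' hs' hp' ho'
    have hsub : {e ∈ G | p ∈ e} ⊆ {s ∈ L | p ∈ h.Z s}.biUnion fun s =>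
        (B s).image fun o => s(p, o) := by
      intro e he
      obtain ⟨he, hpe⟩ := Finset.mem_filter.mp he
      obtain ⟨s, hs, he⟩ := Finset.mem_biUnion.mp he
      obtain ⟨⟨a, b⟩, hab, rfl⟩ := Finset.mem_image.mp he
      obtain ⟨S, hS, hcls, ha, hb, haZ, hbZ⟩ := hcommon s _ hab
      refine Finset.mem_biUnion.mpr ⟨s, Finset.mem_filter.mpr ⟨hs, ?_⟩, ?_⟩
      · rcases Sym2.mem_iff.mp hpe with rfl | rfl <;> assumption
      · rcases Sym2.mem_iff.mp hpe with rfl | rfl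
        · exact Finset.mem_image.mpr ⟨b, Finset.mem_filter.mpr ⟨hbZ, S, hS, hcls, ha, hb⟩, rfl⟩
        · exact Finset.mem_image.mpr ⟨a, Finset.mem_filter.mpr ⟨haZ, S, hS, hcls, hb, ha⟩,
            Sym2.eq_swap⟩
    refine (Finset.card_le_card hsub).trans ((Finset.card_biUnion_le_card_mul _ _ r
      fun s _ => Finset.card_image_le.trans (hBcard s)).trans (Nat.mul_le_mul_right r ?_))
    exact h.card_classes_le p _ fun s hs => (Finset.mem_filter.mp hs).2
  · set F : Finset V → Finset V := fun S => {x ∈ h.Z (cls r S) | x ∈ S} with hF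
    have hsub : G ⊆ T.clusters.biUnion fun S => (F S ×ˢ F S).image fun e => s(e.1, e.2) := by
      intro e he
      obtain ⟨s, hs, he⟩ := Finset.mem_biUnion.mp he
      obtain ⟨e, hab, rfl⟩ := Finset.mem_image.mp he
      obtain ⟨S, hS, rfl, ha, hb, haZ, hbZ⟩ := hcommon s _ hab
      refine Finset.mem_biUnion.mpr ⟨S, hS, Finset.mem_image.mpr ⟨e, ?_, rfl⟩⟩
      exact Finset.mem_product.mpr ⟨Finset.mem_filter.mpr ⟨haZ, ha⟩, Finset.mem_filter.mpr ⟨hbZ, hb⟩⟩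
    refine (totalWeight_mono hsub).trans ((totalWeight_biUnion_le _ _).trans ?_)
    rw [Finset.mul_sum]
    refine Finset.sum_le_sum fun S hS => ?_
    refine (Finset.sum_image_le_of_nonneg fun e _ => edgeWeight_nonneg e).trans ?_
    have h1 : ∀ e ∈ F S ×ˢ F S, edgeWeight s(e.1, e.2) ≤ T.S₀ / 2 ^ T.lev S := by
      intro e he
      obtain ⟨h2, h3⟩ := Finset.mem_product.mp he
      have h4 := (Finset.mem_filter.mp h2).2
      have h5 := (Finset.mem_filter.mp h3).2
      have h6 := T.Q_lev hS h4
      exact T.dist_le (by rwa [h6])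
    refine (Finset.sum_le_card_nsmul _ _ _ h1).trans ?_
    rw [Finset.card_product, nsmul_eq_mul]
    have h2 : (F S).card ≤ r := h.card_Z_le hS (Finset.filter_subset _ _) fun x hx =>
      (Finset.mem_filter.mp hx).2
    have h3 : (((F S).card * (F S).card : ℕ) : ℝ) ≤ r ^ 2 := by
      rw [sq]
      exact_mod_cast Nat.mul_le_mul h2 h2
    exact mul_le_mul_of_nonneg_right h3 (T.scale_nonneg _)
  · intro s u ℓ hu hcls
    refine h.conn_of_reach (hE2 s) (hmemG s) hu hcls (hE3 s u hu _ ?_)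
    exact h.mem_above.mpr ⟨_, T.Q_mem ℓ u, hcls, T.mem_self ℓ u, rfl⟩
  · intro s u v hu hv huniq
    exact hmemG s (u, v) (hE4 s u hu v hv huniq)

/-- The parent of a cluster. -/
noncomputable def parent (S : Finset V) : Finset V := T.Q (T.lev S - 1) (h.D S)

variable {h} {S S' : Finset V} {x : V} {ℓ : ℕ}

theorem parent_mem : h.parent S ∈ T.clusters := T.Q_mem _ _

theorem Q_pred_eq_parent (hS : S ∈ T.clusters) (hx : x ∈ S) : T.Q (T.lev S - 1) x = h.parent S := by
  have h1 : T.Q (T.lev S) x = S := T.Q_lev hS hx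
  have h2 : h.D S ∈ T.Q (T.lev S - 1) x := T.anti (Nat.sub_le _ 1) x (h1.symm ▸ h.D_mem hS)
  exact (T.eq_of_mem h2).symm

theorem subset_parent (hS : S ∈ T.clusters) : S ⊆ h.parent S := by
  intro x hx
  rw [← Q_pred_eq_parent hS hx]
  exact T.mem_self _ x

theorem parent_subset (hS : S ∈ T.clusters) (hS' : S' ∈ T.clusters) (hlt : S ⊂ S') :
    h.parent S ⊆ S' := by
  obtain ⟨x, hx⟩ := T.nonempty_of_mem hS
  rw [← Q_pred_eq_parent hS hx, ← T.Q_lev hS' (hlt.1 hx)]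
  have h1 := T.lt_lev (ℓ := T.lev S') hS hx (by rw [T.Q_lev hS' (hlt.1 hx)]; exact hlt.2)
  exact T.anti (by omega) x

theorem one_le_lev_of_cls_lt (hlt : cls r S < cls r (h.parent S)) (hS : S ∈ T.clusters) :
    1 ≤ T.lev S := by
  by_contra h0
  have h1 : h.parent S = S := by
    rw [parent, show T.lev S - 1 = T.lev S by omega, T.Q_lev hS (h.D_mem hS)]
  rw [h1] at hlt
  omega

variable (h)

open Classical in
/-- The links between hubs of clusters and of their parents, where the size class changes. -/
theorem exists_link_graph (hr : 2 ≤ r) (hR : 2 ≤ R) : ∃ G : Finset (Sym2 V),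
    G.card ≤ T.clusters.card ∧
    (∀ p, {e ∈ G | p ∈ e}.card ≤ 2 * (1 + 2 * r) + 2 * (2 * r * (κ * 1))) ∧
    totalWeight G ≤ 4 * ∑ S ∈ T.clusters, T.S₀ / 2 ^ T.lev S ∧
    ∀ S ∈ T.clusters, cls r S < cls r (h.parent S) →
      Conn G (cls r (h.parent S) - cls r S + 1) (3 * (T.S₀ / 2 ^ (T.lev S - 1)))
        (h.H S) (h.H (h.parent S)) := by
  set I := {S ∈ T.clusters | cls r S < cls r (h.parent S)} with hI
  have hIm : ∀ {S}, S ∈ I ↔ S ∈ T.clusters ∧ cls r S < cls r (h.parent S) := by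
    intro S; simp [hI]
  set c : Finset V → ℕ × V := fun S => (cls r (h.parent S), h.H (h.parent S)) with hc
  have hmemQ : ∀ S ∈ T.clusters, h.H S ∈ h.parent S := fun S hS => subset_parent hS (h.H_mem hS)
  obtain ⟨G, hG1, hG2, hG3, hG4⟩ := exists_star_edges (V := V) (r := r) (J := 1) (K := κ) (m₁ := 2)
    (m₂ := 2) (by omega) one_pos I c (fun S => T.lev S - 1) Finset.card
    (fun S hS => (T.nonempty_of_mem (hIm.mp hS).1).card_pos) (by
      rintro ⟨s, a⟩ m F hFI hF
      refine T.card_clusters_filter_le (m + 1) a _ fun S hS => ?_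
      obtain ⟨hcS, hkey⟩ := hF S hS
      obtain ⟨hS, hlt⟩ := hIm.mp (hFI hS)
      have h1 := one_le_lev_of_cls_lt hlt hS
      have hx := h.D_mem hS
      refine ⟨h.D S, ?_, ?_⟩
      · have h2 : a = h.H (h.parent S) := (congrArg Prod.snd hcS).symm
        have h3 : a ∈ T.Q m (h.D S) := by
          rw [h2, ← hkey]; exact h.H_mem parent_mem
        rw [T.scale_succ]
        have h4 := T.dist_le_of_mem h3 (T.mem_self m (h.D S))
        have h5 : (2 : ℝ) ≤ R := by exact_mod_cast hR
        nlinarith [T.scale_nonneg m]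
      · rw [show m + 1 = T.lev S by omega, T.Q_lev hS hx])
    h.H Prod.snd (by
      intro p F hFI hF
      have key : ∀ S ∈ I, ∀ S' ∈ I, cls r S = cls r S' → ¬ S ⊂ S' := by
        intro S hS S' hS' heq hlt
        rw [hIm] at hS hS'
        have := cls_mono (r := r) (parent_subset (h := h) hS.1 hS'.1 hlt)
        omega
      have hinj : Set.InjOn (cls r) (F : Set (Finset V)) := by
        intro S hS S' hS' heq
        rw [Finset.mem_coe] at hS hS'
        by_contra hne
        have h1 := h.H_mem (hIm.mp (hFI hS)).1
        have h2 := h.H_mem (hIm.mp (hFI hS')).1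
        rw [hF S hS] at h1
        rw [hF S' hS'] at h2
        rcases T.laminar (hIm.mp (hFI hS)).1 (hIm.mp (hFI hS')).1 h1 h2 with h3 | h3
        · exact key S (hFI hS) S' (hFI hS') heq (h3.ssubset_of_ne hne)
        · exact key S' (hFI hS') S (hFI hS) heq.symm (h3.ssubset_of_ne (Ne.symm hne))
      rw [← Finset.card_image_of_injOn hinj]
      refine h.card_classes_le p _ fun s hs => ?_
      obtain ⟨S, hS, rfl⟩ := Finset.mem_image.mp hs
      rw [← hF S hS]
      exact h.H_mem_Z (hIm.mp (hFI hS)).1)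
    (by
      intro p F hF
      have hinj : Set.InjOn Prod.fst (F : Set (ℕ × V)) := by
        intro x hx y hy hxy
        exact Prod.ext hxy ((hF x hx).2.trans (hF y hy).2.symm)
      rw [← Finset.card_image_of_injOn hinj]
      refine h.card_classes_le p _ fun s hs => ?_
      obtain ⟨x, hx, rfl⟩ := Finset.mem_image.mp hs
      obtain ⟨⟨S, hS, rfl⟩, rfl⟩ := hF x hx
      exact h.H_mem_Z parent_mem) (A := 1) zero_le_one T.S₀_pos.le (by
      intro S hS
      rw [one_mul]
      exact T.dist_le_of_mem (hmemQ S (hIm.mp hS).1) (h.H_mem parent_mem))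
  refine ⟨G, hG1.trans (Finset.card_filter_le _ _), hG2, hG3.trans ?_, ?_⟩
  · rw [Finset.mul_sum]
    refine (Finset.sum_le_sum fun S hS => ?_).trans (Finset.sum_le_sum_of_subset_of_nonneg
      (Finset.filter_subset _ _) fun S _ _ => mul_nonneg (by norm_num) (T.scale_nonneg _))
    have h1 := one_le_lev_of_cls_lt (hIm.mp hS).2 (hIm.mp hS).1
    have h2 := T.scale_succ (T.lev S - 1)
    rw [Nat.sub_add_cancel h1] at h2
    rw [h2]
    linarith
  · intro S hS hlt
    obtain ⟨n, F, hFI, hF, hn, hconn⟩ := hG4 S (hIm.mpr ⟨hS, hlt⟩)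
    have hsum : ∑ S' ∈ F, S'.card < r ^ (cls r (h.parent S) + 1) := by
      obtain ⟨M, hM, hMs, -, hmax⟩ := exists_largest (r := r) (parent_mem (h := h) (S := S))
        (h.H_mem parent_mem)
      rw [← hMs]
      refine lt_of_le_of_lt ?_ (lt_pow_cls hr M)
      rw [← Finset.card_biUnion]
      · refine Finset.card_le_card (Finset.biUnion_subset.mpr fun S' hS' => ?_)
        have hcS := hF S' hS'
        have h2 : h.H (h.parent S') = h.H (h.parent S) := congrArg Prod.snd hcS
        refine (subset_parent (hIm.mp (hFI hS')).1).trans (hmax _ parent_mem (congrArg Prod.fst hcS) ?_)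
        rw [← h2]
        exact h.H_mem parent_mem
      · have key : ∀ S₁ ∈ I, ∀ S₂ ∈ I, c S₁ = c S₂ → ¬ S₁ ⊂ S₂ := by
          intro S₁ hS₁ S₂ hS₂ heq hss
          rw [hIm] at hS₁ hS₂
          have h1 := cls_mono (r := r) (parent_subset (h := h) hS₁.1 hS₂.1 hss)
          have h2 : cls r (h.parent S₁) = cls r (h.parent S₂) := congrArg Prod.fst heq
          omega
        intro S₁ hS₁ S₂ hS₂ hne
        rw [Finset.mem_coe] at hS₁ hS₂
        have heq := (hF S₁ hS₁).trans (hF S₂ hS₂).symm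
        rw [Function.onFun, Finset.disjoint_left]
        intro x hx hx'
        rcases T.laminar (hIm.mp (hFI hS₁)).1 (hIm.mp (hFI hS₂)).1 hx hx' with h3 | h3
        · exact key S₁ (hFI hS₁) S₂ (hFI hS₂) heq (h3.ssubset_of_ne hne)
        · exact key S₂ (hFI hS₂) S₁ (hFI hS₁) heq.symm (h3.ssubset_of_ne (Ne.symm hne))
    have h1 : r ^ (n + cls r S) < r ^ (cls r (h.parent S) + 1) := by
      rw [pow_add]
      exact (Nat.mul_le_mul_left _ (T.pow_cls_le hS)).trans_lt (hn.trans_lt hsum)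
    have h2 := (Nat.pow_lt_pow_iff_right (by omega)).mp h1
    refine hconn.mono (by omega) ?_
    have h3 := T.dist_le_of_mem (hmemQ S hS) (h.H_mem parent_mem)
    have h4 : dist (h.H S) (c S).2 ≤ T.S₀ / 2 ^ (T.lev S - 1) := h3
    norm_num
    linarith

end HubSystem

end Hierarchy

namespace Hierarchy

variable {V : Type} [MetricSpace V] [Fintype V] {R κ : ℕ} {T : Hierarchy V R κ} {r : ℕ}

theorem exists_last_level {S : Finset V} (hS : S ∈ T.clusters) : ∃ e, T.lev S ≤ e ∧
    (∀ x ∈ S, T.Q e x = S) ∧ ∀ ℓ x, ℓ ≤ T.top → T.Q ℓ x = S → ℓ ≤ e := by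
  classical
  obtain ⟨y, hy⟩ := T.nonempty_of_mem hS
  have htop : T.lev S ≤ T.top := by
    obtain ⟨ℓ, x, hx⟩ := T.mem_clusters.mp hS
    rcases le_total ℓ T.top with h | h
    · exact (T.lev_le hx).trans h
    · exact T.lev_le (x := x) (by rw [T.top_eq, ← hx, T.eq_singleton h])
  set F := {ℓ ∈ Finset.range (T.top + 1) | T.Q ℓ y = S} with hF
  have hne : F.Nonempty := ⟨T.lev S, Finset.mem_filter.mpr
    ⟨Finset.mem_range.mpr (by omega), T.Q_lev hS hy⟩⟩
  have hmem := Finset.mem_filter.mp (F.max'_mem hne)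
  refine ⟨F.max' hne, T.lev_le hmem.2, fun x hx => ?_, fun ℓ x hℓ hx => ?_⟩
  · rw [← hmem.2] at hx
    rw [T.eq_of_mem hx, hmem.2]
  · refine F.le_max' ℓ (Finset.mem_filter.mpr ⟨Finset.mem_range.mpr (by omega), ?_⟩)
    rw [← hx] at hy
    rw [T.eq_of_mem hy, hx]

/-- The deepest level at which the part of `x` still has its size class. -/
theorem exists_deepest_level (x : V) {ℓ : ℕ} (hℓ : ℓ ≤ T.top) : ∃ m, ℓ ≤ m ∧ m ≤ T.top ∧
    cls r (T.Q m x) = cls r (T.Q ℓ x) ∧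
    (m = T.top ∨ cls r (T.Q (m + 1) x) < cls r (T.Q ℓ x)) := by
  classical
  set m := Nat.findGreatest (fun m => cls r (T.Q m x) = cls r (T.Q ℓ x)) T.top with hm
  have h1 : ℓ ≤ m := Nat.le_findGreatest hℓ rfl
  have h2 : m ≤ T.top := Nat.findGreatest_le _
  refine ⟨m, h1, h2, Nat.findGreatest_spec (P := fun m => cls r (T.Q m x) = cls r (T.Q ℓ x)) hℓ rfl,
    ?_⟩
  by_contra! hcon
  have h3 : cls r (T.Q (m + 1) x) ≤ cls r (T.Q ℓ x) := cls_mono (T.anti (by omega) x)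
  exact Nat.findGreatest_is_greatest (P := fun m => cls r (T.Q m x) = cls r (T.Q ℓ x))
    (n := T.top) (k := m + 1) (by omega) (by omega) (le_antisymm h3 hcon.2)

namespace HubSystem

variable (h : T.HubSystem r)

open Classical in
/-- Stars that connect the delegates of clusters to their hubs. -/
theorem exists_delegate_graph (hr : 2 ≤ r) : ∃ G : Finset (Sym2 V),
    G.card ≤ T.clusters.card ∧
    (∀ p, {e ∈ G | p ∈ e}.card ≤ 2 * (1 + 2 * r) + 2 * (2 * r * (1 * 1))) ∧
    totalWeight G ≤ 2 * ∑ S ∈ T.clusters, T.S₀ / 2 ^ T.lev S ∧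
    ∀ ℓ ≤ T.top, ∀ x, Conn G (Nat.log r T.clusters.card + 1) (3 * (T.S₀ / 2 ^ ℓ))
        (h.D (T.Q ℓ x)) (h.H (T.Q ℓ x)) := by
  have hex : ∀ S : Finset V, ∃ e, S ∈ T.clusters → T.lev S ≤ e ∧
    (∀ x ∈ S, T.Q e x = S) ∧ ∀ ℓ x, ℓ ≤ T.top → T.Q ℓ x = S → ℓ ≤ e := by
    intro S
    by_cases hS : S ∈ T.clusters
    · obtain ⟨e, he⟩ := exists_last_level hS
      exact ⟨e, fun _ => he⟩
    · exact ⟨0, fun h => absurd h hS⟩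
  choose e he using hex
  set c : Finset V → ℕ × V := fun S => (cls r S, h.H S) with hc
  obtain ⟨G, hG1, hG2, hG3, hG4⟩ := exists_star_edges (V := V) (r := r) (J := 1) (K := 1) (m₁ := 2)
    (m₂ := 2) (by omega) one_pos T.clusters c e (fun _ => 1)
    (fun S hS => le_rfl) (by
      rintro ⟨s, a⟩ m F hFI hF
      rw [Finset.card_le_one]
      have key : ∀ S ∈ F, T.Q m a = S := by
        intro S hS
        have h1 : h.H S = a := congrArg Prod.snd (hF S hS).1
        have h2 := (he S (hFI hS)).2.1 a (h1 ▸ h.H_mem (hFI hS))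
        rwa [(hF S hS).2] at h2
      intro S hS S' hS'
      rw [← key S hS, key S' hS'])
    h.D Prod.snd h.D_fiber
    (by
      intro p F hF
      have hinj : Set.InjOn Prod.fst (F : Set (ℕ × V)) := by
        intro x hx y hy hxy
        exact Prod.ext hxy ((hF x hx).2.trans (hF y hy).2.symm)
      rw [← Finset.card_image_of_injOn hinj]
      refine h.card_classes_le p _ fun s hs => ?_
      obtain ⟨x, hx, rfl⟩ := Finset.mem_image.mp hs
      obtain ⟨⟨S, hS, rfl⟩, rfl⟩ := hF x hx
      exact h.H_mem_Z hS) (A := 1) zero_le_one T.S₀_pos.le (by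
      intro S hS
      rw [one_mul]
      have h1 := (he S hS).2.1 _ (h.D_mem hS)
      exact T.dist_le (by rw [h1]; exact h.H_mem hS))
  refine ⟨G, hG1, hG2, hG3.trans ?_, ?_⟩
  · rw [Finset.mul_sum]
    refine Finset.sum_le_sum fun S hS => ?_
    have := T.scale_anti (he S hS).1
    linarith
  · intro ℓ hℓ x
    have hS := T.Q_mem ℓ x
    obtain ⟨n, F, hFI, -, hn, hconn⟩ := hG4 _ hS
    have h1 : n ≤ Nat.log r T.clusters.card := by
      apply Nat.le_log_of_pow_le (by omega)
      have := Finset.card_le_card hFI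
      simp only [Finset.sum_const, smul_eq_mul, mul_one] at hn
      omega
    refine hconn.mono (by omega) ?_
    have h2 : dist (h.D (T.Q ℓ x)) (c (T.Q ℓ x)).2 ≤ T.S₀ / 2 ^ ℓ :=
      T.dist_le_of_mem (h.D_mem hS) (h.H_mem hS)
    have h3 := T.scale_anti ((he _ hS).2.2 ℓ x hℓ rfl)
    norm_num
    linarith

theorem above_eq_singleton {S : Finset V} (hS : S ∈ T.clusters)
    (hlt : cls r S < cls r (h.parent S)) : h.above (cls r S) (h.H S) = {h.H S} := by
  have key : ∀ S' ∈ T.clusters, cls r S' = cls r S → h.H S ∈ S' → S' ⊆ S := by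
    intro S' hS' hcls hmem
    rcases T.laminar hS hS' (h.H_mem hS) hmem with h1 | h1
    · by_contra h2
      have := cls_mono (r := r) (parent_subset (h := h) hS hS' ⟨h1, h2⟩)
      omega
    · exact h1
  ext v
  rw [Finset.mem_singleton, h.mem_above]
  constructor
  · rintro ⟨S', hS', hcls, hmem, rfl⟩
    exact h.H_eq_of_subset hS' hS hcls (key S' hS' hcls hmem) hmem
  · rintro rfl
    exact ⟨S, hS, rfl, h.H_mem hS, rfl⟩

open Classical in
/-- A sparse graph in which every point is connected to the delegates of the clusters that
contain it. -/
theorem exists_climb_graph (hr : 2 ≤ r) (hR : 2 ≤ R) {k : ℕ} (hk : r ≤ ack k k) :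
    ∃ G : Finset (Sym2 V), G.card ≤ 44 * Fintype.card V + 2 * T.clusters.card ∧
    (∀ p, {e ∈ G | p ∈ e}.card ≤ 14 * r + 4 + 4 * r * κ) ∧
    totalWeight G ≤ (r ^ 2 + 6) * ∑ S ∈ T.clusters, T.S₀ / 2 ^ T.lev S ∧
    ∀ ℓ x, Conn G (3 * Nat.log r (Fintype.card V) + 2 * k + 6 + Nat.log r T.clusters.card)
      (12 * (T.S₀ / 2 ^ ℓ)) x (h.D (T.Q ℓ x)) := by
  obtain ⟨G₁, hc₁, hd₁, hw₁, hG₁, hG₁'⟩ := h.exists_hub_graph hk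
  obtain ⟨G₂, hc₂, hd₂, hw₂, hG₂⟩ := h.exists_link_graph hr hR
  obtain ⟨G₃, hc₃, hd₃, hw₃, hG₃⟩ := h.exists_delegate_graph hr
  set G := G₁ ∪ (G₂ ∪ G₃) with hG
  have hs₁ : G₁ ⊆ G := Finset.subset_union_left
  have hs₂ : G₂ ⊆ G := Finset.subset_union_left.trans Finset.subset_union_right
  have hs₃ : G₃ ⊆ G := Finset.subset_union_right.trans Finset.subset_union_right
  have climb : ∀ s x ℓ, ℓ ≤ T.top → cls r (T.Q ℓ x) = s →
      (ℓ = T.top ∨ cls r (T.Q (ℓ + 1) x) < s) →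
      Conn G (3 * s) (7 * (T.S₀ / 2 ^ ℓ)) x (h.H (T.Q ℓ x)) := by
    intro s
    induction s using Nat.strong_induction_on with
    | _ s ih =>
    intro x ℓ hℓ hs hor
    have hpos := T.scale_nonneg ℓ
    rcases eq_or_lt_of_le hℓ with rfl | hℓ'
    · have h1 : h.H (T.Q T.top x) = x := by
        have := h.H_mem (T.Q_mem T.top x)
        rw [T.top_eq] at this ⊢
        exact Finset.mem_singleton.mp this
      rw [h1]
      exact Conn.refl _ (by linarith) x
    have hlt := hor.resolve_left hℓ'.ne
    set S := T.Q (ℓ + 1) x with hS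
    have hSm : S ∈ T.clusters := T.Q_mem _ _
    have hlev : T.lev S = ℓ + 1 := by
      refine le_antisymm (T.lev_le hS.symm) ?_
      by_contra! hcon
      have := T.Q_eq_of_le (m := ℓ) hS.symm (by omega) (by omega)
      rw [this] at hs
      omega
    have hpar : h.parent S = T.Q ℓ x := by
      rw [← Q_pred_eq_parent hSm (T.mem_self (ℓ + 1) x), hlev, Nat.add_sub_cancel]
    obtain ⟨m, hm1, hm2, hm3, hm4⟩ := exists_deepest_level (T := T) (r := r) x
      (show ℓ + 1 ≤ T.top by omega)
    have c1 := ih _ hlt x m hm2 hm3 hm4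
    have hsub : T.Q m x ⊆ S := T.anti hm1 x
    have hlt' : cls r S < cls r (h.parent S) := by rw [hpar, hs]; exact hlt
    have hu : h.H (T.Q m x) ∈ S := hsub (h.H_mem (T.Q_mem m x))
    have e2 := hG₁' (cls r S) (h.H (T.Q m x)) (h.H S)
      (h.mem_hubs.mpr ⟨_, T.Q_mem m x, hm3, rfl⟩) (h.mem_above.mpr ⟨S, hSm, rfl, hu, rfl⟩)
      (h.above_eq_singleton hSm hlt')
    have c2 := (Conn.of_mem e2).mono_graph hs₁
    have c3 := (hG₂ S hSm hlt').mono_graph hs₂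
    rw [hpar] at c3
    have d1 := T.scale_anti hm1
    have d2 := T.scale_succ ℓ
    have d3 : dist (h.H (T.Q m x)) (h.H S) ≤ T.S₀ / 2 ^ (ℓ + 1) :=
      T.dist_le_of_mem hu (h.H_mem hSm)
    refine ((c1.trans c2).trans c3).mono ?_ ?_
    · rw [hs]; omega
    · rw [hlev, Nat.add_sub_cancel]
      linarith
  refine ⟨G, ?_, ?_, ?_, ?_⟩
  · have h1 := Finset.card_union_le G₁ (G₂ ∪ G₃)
    have h2 := Finset.card_union_le G₂ G₃
    rw [← hG] at h1
    omega
  · intro p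
    rw [hG, Finset.filter_union, Finset.filter_union]
    have h1 := Finset.card_union_le {e ∈ G₁ | p ∈ e} ({e ∈ G₂ | p ∈ e} ∪ {e ∈ G₃ | p ∈ e})
    have h2 := Finset.card_union_le {e ∈ G₂ | p ∈ e} {e ∈ G₃ | p ∈ e}
    have h3 := hd₁ p
    have h4 := hd₂ p
    have h5 := hd₃ p
    nlinarith
  · have h1 := totalWeight_union_le G₁ (G₂ ∪ G₃)
    have h2 := totalWeight_union_le G₂ G₃
    linarith
  · intro ℓ x
    have hpos := T.scale_nonneg ℓ
    rcases lt_or_ge T.top ℓ with hℓ | hℓ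
    · have h1 : h.D (T.Q ℓ x) = x := by
        have := h.D_mem (T.Q_mem ℓ x)
        rw [T.eq_singleton hℓ.le] at this ⊢
        exact Finset.mem_singleton.mp this
      rw [h1]
      exact Conn.refl _ (by linarith) x
    obtain ⟨m, hm1, hm2, hm3, hm4⟩ := exists_deepest_level (T := T) (r := r) x hℓ
    have c1 := climb _ x m hm2 hm3 hm4
    set u := h.H (T.Q m x) with hu
    have hQu : T.Q ℓ u = T.Q ℓ x := T.eq_of_mem (T.anti hm1 x (h.H_mem (T.Q_mem m x)))
    have c2 := (hG₁ (cls r (T.Q ℓ x)) u ℓ (h.mem_hubs.mpr ⟨_, T.Q_mem m x, hm3, rfl⟩)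
      (by rw [hQu])).mono_graph hs₁
    rw [hQu] at c2
    have c3 := ((hG₃ ℓ hℓ x).mono_graph hs₃).symm
    have h1 : cls r (T.Q ℓ x) ≤ Nat.log r (Fintype.card V) :=
      Nat.log_mono_right (Finset.card_le_univ _)
    have d1 := T.scale_anti hm1
    exact ((c1.trans c2).trans c3).mono (by omega) (by linarith)

end HubSystem

end Hierarchy

namespace Hierarchy

variable {V : Type} [MetricSpace V] [Fintype V] {R κ : ℕ} {T : Hierarchy V R κ} {r : ℕ}

/-- Two distinct points are separated at a suitable scale. -/
theorem exists_scale (T : Hierarchy V R κ) {c : ℕ} (hc : 1 ≤ c) {p q : V} (hpq : p ≠ q) :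
    ∃ ℓ, c * (T.S₀ / 2 ^ ℓ) ≤ dist p q ∧ dist p q < 2 * c * (T.S₀ / 2 ^ ℓ) := by
  classical
  have hpos := T.S₀_pos
  have hc' : (1 : ℝ) ≤ c := by exact_mod_cast hc
  have hd : 0 < dist p q := dist_pos.mpr hpq
  have hex : ∃ ℓ, c * (T.S₀ / 2 ^ ℓ) ≤ dist p q := by
    obtain ⟨ℓ, hℓ⟩ := pow_unbounded_of_one_lt (c * T.S₀ / dist p q) (one_lt_two (α := ℝ))
    refine ⟨ℓ, ?_⟩
    rw [div_lt_iff₀ hd] at hℓ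
    rw [← mul_div_assoc, div_le_iff₀ (by positivity)]
    linarith
  refine ⟨Nat.find hex, Nat.find_spec hex, ?_⟩
  rcases hn : Nat.find hex with _ | n
  · have h1 : dist p q ≤ T.S₀ / 2 ^ 0 := T.dist_le (by rw [T.zero_eq]; exact Finset.mem_univ _)
    simp only [pow_zero, div_one] at h1 ⊢
    nlinarith
  · have h1 := Nat.find_min hex (m := n) (by omega)
    rw [T.scale_succ]
    linarith

namespace HubSystem

variable (h : T.HubSystem r)

open Classical in
/-- Stars that connect the delegates of clusters whose distance is comparable to their scale. -/
theorem exists_cross_graph (hr : 2 ≤ r) {c J : ℕ} (hc : 2 ≤ c) (hJ : 0 < J) (hR : 2 * c + 1 ≤ R) :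
    ∃ G : Finset (Sym2 V),
    G.card ≤ κ * T.clusters.card ∧
    (∀ p, {e ∈ G | p ∈ e}.card ≤ 2 * κ * (1 + 2 * r) + 2 * (2 * r * (κ * J))) ∧
    totalWeight G ≤ κ * (2 * (2 * c + 2)) * ∑ S ∈ T.clusters, T.S₀ / 2 ^ T.lev S ∧
    ∀ ℓ p q, c * (T.S₀ / 2 ^ ℓ) ≤ dist p q → dist p q < 2 * c * (T.S₀ / 2 ^ ℓ) →
      Conn G (Nat.log r (κ * T.clusters.card) + 1)
        ((1 + 32 / 2 ^ J) * dist p q + 2 * (T.S₀ / 2 ^ ℓ)) (h.D (T.Q ℓ p)) (h.D (T.Q ℓ q)) := by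
  have hc' : (2 : ℝ) ≤ c := by exact_mod_cast hc
  have hR' : 2 * (c : ℝ) + 1 ≤ R := by exact_mod_cast hR
  set W : ℕ → Finset V × Finset V → Prop := fun ℓ S => ∃ p q, T.Q ℓ p = S.1 ∧ T.Q ℓ q = S.2 ∧
    c * (T.S₀ / 2 ^ ℓ) ≤ dist p q ∧ dist p q < 2 * c * (T.S₀ / 2 ^ ℓ) with hW
  set I := {S ∈ T.clusters ×ˢ T.clusters | T.lev S.2 ≤ T.lev S.1 ∧ ∃ ℓ, W ℓ S} with hI
  have hIm : ∀ {S}, S ∈ I ↔ (S.1 ∈ T.clusters ∧ S.2 ∈ T.clusters) ∧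
      T.lev S.2 ≤ T.lev S.1 ∧ ∃ ℓ, W ℓ S := by
    intro S; simp [hI]
  set key : Finset V × Finset V → ℕ := fun S => if hS : ∃ ℓ, W ℓ S then hS.choose else 0 with hkey
  have hkeyW : ∀ {S}, S ∈ I → W (key S) S := by
    intro S hS
    have h1 := (hIm.mp hS).2.2
    simp only [hkey, dif_pos h1]
    exact h1.choose_spec
  have hfst : ∀ S, ∀ F ⊆ I, (∀ i ∈ F, i.1 = S) → F.card ≤ κ := by
    intro S F hF hS
    have hinj : Set.InjOn Prod.snd (F : Set (Finset V × Finset V)) := fun x hx y hy hxy =>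
      Prod.ext ((hS x hx).trans (hS y hy).symm) hxy
    rw [← Finset.card_image_of_injOn hinj]
    refine T.card_clusters_filter_le (T.lev S) (h.D S) _ fun S' hS' => ?_
    obtain ⟨⟨S₁, S₂⟩, hi, rfl⟩ := Finset.mem_image.mp hS'
    obtain rfl : S₁ = S := hS _ hi
    obtain ⟨⟨hS₁, hS₂⟩, hlev, ℓ, p, q, hp, hq, h1, h2⟩ := hIm.mp (hF hi)
    dsimp only at hS₁ hS₂ hlev hp hq
    have h3 : T.lev S₁ ≤ ℓ := T.lev_le hp
    refine ⟨q, ?_, T.Q_eq_of_le hq hlev h3⟩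
    have hp' : p ∈ S₁ := hp ▸ T.mem_self ℓ p
    have h4 : dist (h.D S₁) p ≤ T.S₀ / 2 ^ T.lev S₁ :=
      T.dist_le (by rw [T.Q_lev hS₁ (h.D_mem hS₁)]; exact hp')
    have h5 := T.scale_anti h3
    have h6 := dist_triangle (h.D S₁) p q
    nlinarith [T.scale_nonneg (T.lev S₁)]
  have hIcard : I.card ≤ κ * T.clusters.card := by
    refine (Finset.card_le_mul_card_image (f := Prod.fst) I κ fun S _ => hfst S _
      (Finset.filter_subset _ _) fun i hi => (Finset.mem_filter.mp hi).2).trans ?_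
    refine Nat.mul_le_mul_left κ (Finset.card_le_card fun S hS => ?_)
    obtain ⟨i, hi, rfl⟩ := Finset.mem_image.mp hS
    exact (hIm.mp hi).1.1
  obtain ⟨G, hG1, hG2, hG3, hG4⟩ := exists_star_edges (V := V) (r := r) (J := J) (K := κ)
    (m₁ := 2 * κ) (m₂ := 2) (by omega) hJ I Prod.snd key (fun _ => 1) (fun S hS => le_rfl) (by
      intro S m F hFI hF
      have hinj : Set.InjOn Prod.fst (F : Set (Finset V × Finset V)) := fun x hx y hy hxy =>
        Prod.ext hxy ((hF x hx).1.trans (hF y hy).1.symm)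
      rw [← Finset.card_image_of_injOn hinj]
      refine T.card_clusters_filter_le m (h.D S) _ fun S' hS' => ?_
      obtain ⟨i, hi, rfl⟩ := Finset.mem_image.mp hS'
      obtain ⟨rfl, rfl⟩ := hF i hi
      obtain ⟨p, q, hp, hq, h1, h2⟩ := hkeyW (hFI hi)
      refine ⟨p, ?_, hp⟩
      have h4 : dist q (h.D i.2) ≤ T.S₀ / 2 ^ key i :=
        T.dist_le (by rw [hq]; exact h.D_mem (hIm.mp (hFI hi)).1.2)
      have h6 := dist_triangle p q (h.D i.2)
      rw [dist_comm]
      nlinarith [T.scale_nonneg (key i)])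
    (fun S => h.D S.1) h.D
    (by
      intro p F hFI hF
      refine (Finset.card_le_mul_card_image (f := Prod.fst) F κ fun S _ => hfst S _
        ((Finset.filter_subset _ _).trans hFI) fun i hi => (Finset.mem_filter.mp hi).2).trans ?_
      rw [mul_comm]
      refine Nat.mul_le_mul_right κ (h.D_fiber p _ (fun S hS => ?_) fun S hS => ?_)
      · obtain ⟨i, hi, rfl⟩ := Finset.mem_image.mp hS
        exact (hIm.mp (hFI hi)).1.1
      · obtain ⟨i, hi, rfl⟩ := Finset.mem_image.mp hS
        exact hF i hi)
    (by
      intro p F hF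
      refine h.D_fiber p F (fun S hS => ?_) fun S hS => (hF S hS).2
      obtain ⟨⟨i, hi, rfl⟩, -⟩ := hF S hS
      exact (hIm.mp hi).1.2)
    (A := 2 * c + 2) (by positivity) T.S₀_pos.le (by
      intro i hi
      obtain ⟨p, q, hp, hq, h1, h2⟩ := hkeyW hi
      have h3 : dist p (h.D i.1) ≤ T.S₀ / 2 ^ key i :=
        T.dist_le (by rw [hp]; exact h.D_mem (hIm.mp hi).1.1)
      have h4 : dist q (h.D i.2) ≤ T.S₀ / 2 ^ key i :=
        T.dist_le (by rw [hq]; exact h.D_mem (hIm.mp hi).1.2)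
      rw [dist_comm] at h3
      have := dist_triangle4 (h.D i.1) p q (h.D i.2)
      linarith)
  refine ⟨G, hG1.trans hIcard, hG2, hG3.trans ?_, ?_⟩
  · rw [← Finset.sum_fiberwise_of_maps_to (g := Prod.fst) (t := T.clusters)
      fun i hi => (hIm.mp hi).1.1, Finset.mul_sum]
    refine Finset.sum_le_sum fun S hS => ?_
    have hpos := T.scale_nonneg (T.lev S)
    refine (Finset.sum_le_card_nsmul _ _ (2 * (2 * c + 2) * (T.S₀ / 2 ^ T.lev S))
      fun i hi => ?_).trans ?_
    · obtain ⟨hi', rfl⟩ := Finset.mem_filter.mp hi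
      obtain ⟨p, q, hp, -⟩ := hkeyW hi'
      exact mul_le_mul_of_nonneg_left (T.scale_anti (T.lev_le hp)) (by positivity)
    · rw [nsmul_eq_mul, mul_assoc (κ : ℝ)]
      refine mul_le_mul_of_nonneg_right ?_ (by positivity)
      exact_mod_cast hfst S _ (Finset.filter_subset _ _) fun i hi => (Finset.mem_filter.mp hi).2
  · have main : ∀ ℓ p q, c * (T.S₀ / 2 ^ ℓ) ≤ dist p q → dist p q < 2 * c * (T.S₀ / 2 ^ ℓ) →
        T.lev (T.Q ℓ q) ≤ T.lev (T.Q ℓ p) →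
        Conn G (Nat.log r (κ * T.clusters.card) + 1)
        ((1 + 32 / 2 ^ J) * dist p q + 2 * (T.S₀ / 2 ^ ℓ)) (h.D (T.Q ℓ p)) (h.D (T.Q ℓ q)) := by
      intro ℓ p q h1 h2 hle
      have hi : (T.Q ℓ p, T.Q ℓ q) ∈ I :=
        hIm.mpr ⟨⟨T.Q_mem ℓ p, T.Q_mem ℓ q⟩, hle, ℓ, p, q, rfl, rfl, h1, h2⟩
      obtain ⟨n, F, hFI, -, hn, hconn⟩ := hG4 _ hi
      have h3 : n ≤ Nat.log r (κ * T.clusters.card) := by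
        apply Nat.le_log_of_pow_le (by omega)
        have := Finset.card_le_card hFI
        simp only [Finset.sum_const, smul_eq_mul, mul_one] at hn
        omega
      refine hconn.mono (by omega) ?_
      obtain ⟨p', q', hp', hq', h4, -⟩ := hkeyW hi
      dsimp only at hp' hq' ⊢
      have d1 : dist (h.D (T.Q ℓ p)) p ≤ T.S₀ / 2 ^ ℓ :=
        T.dist_le_of_mem (h.D_mem (T.Q_mem ℓ p)) (T.mem_self ℓ p)
      have d2 : dist q (h.D (T.Q ℓ q)) ≤ T.S₀ / 2 ^ ℓ :=
        T.dist_le_of_mem (T.mem_self ℓ q) (h.D_mem (T.Q_mem ℓ q))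
      have d3 : dist p' p ≤ T.S₀ / 2 ^ ℓ :=
        T.dist_le_of_mem (y := p) (by rw [← hp']; exact T.mem_self _ _) (T.mem_self ℓ p)
      have d4 : dist q q' ≤ T.S₀ / 2 ^ ℓ :=
        T.dist_le_of_mem (T.mem_self ℓ q) (by rw [← hq']; exact T.mem_self _ _)
      have d5 := dist_triangle4 (h.D (T.Q ℓ p)) p q (h.D (T.Q ℓ q))
      have d6 := dist_triangle4 p' p q q'
      set s := T.S₀ / 2 ^ key (T.Q ℓ p, T.Q ℓ q) with hs
      have d7 : c * s ≤ 2 * dist p q := by nlinarith [T.scale_nonneg ℓ]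
      have d8 : 4 * (2 * (c : ℝ) + 2) * s ≤ 32 * dist p q := by
        have : 0 ≤ s := T.scale_nonneg _
        nlinarith
      have d9 : 4 * (2 * (c : ℝ) + 2) / 2 ^ J * s ≤ 32 / 2 ^ J * dist p q := by
        rw [div_mul_eq_mul_div, div_mul_eq_mul_div]
        gcongr
      linarith
    intro ℓ p q h1 h2
    rcases le_total (T.lev (T.Q ℓ q)) (T.lev (T.Q ℓ p)) with hle | hle
    · exact main ℓ p q h1 h2 hle
    · rw [dist_comm] at h1 h2
      have := (main ℓ q p h1 h2 hle).symm
      rwa [dist_comm] at this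

end HubSystem

open Classical in
/-- The spanner of a hierarchy, with its lightness bounded in terms of the scales of clusters. -/
theorem exists_spanner [Nonempty V] (T : Hierarchy V R κ) (hr : 2 ≤ r) {k : ℕ}
    (hk : r ≤ ack k k) {c J : ℕ} (hc : 2 ≤ c) (hJ : 0 < J) (hR : 2 * c + 1 ≤ R) :
    ∃ G : Finset (Sym2 V),
    G.card ≤ 44 * Fintype.card V + (2 + κ) * T.clusters.card ∧
    (∀ p, {e ∈ G | p ∈ e}.card ≤ 14 * r + 4 + 4 * r * κ + 2 * κ * (1 + 2 * r) + 4 * r * κ * J) ∧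
    totalWeight G ≤ (r ^ 2 + 6 + κ * (4 * c + 4)) * ∑ S ∈ T.clusters, T.S₀ / 2 ^ T.lev S ∧
    ∀ p q, Conn G (6 * Nat.log r (Fintype.card V) + 4 * k + 13 + 2 * Nat.log r T.clusters.card
        + Nat.log r (κ * T.clusters.card)) ((1 + 26 / c + 32 / 2 ^ J) * dist p q) p q := by
  obtain ⟨h⟩ := T.exists_hubSystem hr
  obtain ⟨G₁, hc₁, hd₁, hw₁, hG₁⟩ := h.exists_climb_graph hr (by omega) hk
  obtain ⟨G₂, hc₂, hd₂, hw₂, hG₂⟩ := h.exists_cross_graph hr hc hJ hR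
  refine ⟨G₁ ∪ G₂, ?_, ?_, ?_, ?_⟩
  · have h1 := Finset.card_union_le G₁ G₂
    nlinarith
  · intro p
    rw [Finset.filter_union]
    have h1 := Finset.card_union_le {e ∈ G₁ | p ∈ e} {e ∈ G₂ | p ∈ e}
    have h2 := hd₁ p
    have h3 := hd₂ p
    nlinarith
  · have h1 := totalWeight_union_le G₁ G₂
    linarith
  · intro p q
    by_cases hpq : p = q
    · subst hpq
      exact Conn.refl _ (by simp) p
    obtain ⟨ℓ, h1, h2⟩ := T.exists_scale (c := c) (by omega) hpq
    have c1 := (hG₁ ℓ p).mono_graph (Finset.subset_union_left (s₂ := G₂))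
    have c2 := (hG₂ ℓ p q h1 h2).mono_graph (Finset.subset_union_right (s₁ := G₁))
    have c3 := ((hG₁ ℓ q).mono_graph (Finset.subset_union_left (s₂ := G₂))).symm
    refine ((c1.trans c2).trans c3).mono (by omega) ?_
    have hc0 : (0 : ℝ) < c := by exact_mod_cast (show 0 < c by omega)
    have h3 : T.S₀ / 2 ^ ℓ ≤ dist p q / c := by
      rw [le_div_iff₀ hc0]
      linarith
    have h4 : 26 / c * dist p q = 26 * (dist p q / c) := by ring
    linarith

end Hierarchy

section SpanningTrees

variable {V : Type}

/-- The variation of a function along an edge. -/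
noncomputable def variation (f : V → ℝ) (e : Sym2 V) : ℝ :=
  Sym2.lift ⟨fun p q => |f p - f q|, fun p q => abs_sub_comm (f p) (f q)⟩ e

theorem variation_mk (f : V → ℝ) (p q : V) : variation f s(p, q) = |f p - f q| := rfl

theorem variation_nonneg (f : V → ℝ) (e : Sym2 V) : 0 ≤ variation f e := by
  induction e with
  | _ p q => exact abs_nonneg _

theorem sub_le_sum_variation {G : Finset (Sym2 V)} (hG : IsConnectedOn G) (f : V → ℝ) (u v : V) :
    f u - f v ≤ ∑ e ∈ G, variation f e := by
  classical
  set Γ := SimpleGraph.fromEdgeSet (G : Set (Sym2 V)) with hΓ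
  have hreach : Γ.Reachable u v := by
    obtain ⟨k, x, rfl, rfl, hx⟩ := hG u v
    have h1 : ∀ i : Fin (k + 1), Γ.Reachable (x 0) (x i) := by
      intro i
      induction i using Fin.induction with
      | zero => exact SimpleGraph.Reachable.refl _
      | succ i ih =>
        refine ih.trans ?_
        by_cases hne : x i.castSucc = x i.succ
        · rw [hne]
        · refine SimpleGraph.Adj.reachable ?_
          rw [hΓ, SimpleGraph.fromEdgeSet_adj]
          exact ⟨hx i, hne⟩
    exact h1 _
  have hwalk : ∀ {a b : V} (w : Γ.Walk a b), f a - f b ≤ (w.edges.map (variation f)).sum := by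
    intro a b w
    induction w with
    | nil => simp
    | @cons a b c hadj w ih =>
      rw [SimpleGraph.Walk.edges_cons, List.map_cons, List.sum_cons, variation_mk]
      have := le_abs_self (f a - f b)
      linarith
  obtain ⟨w, hw⟩ := hreach.exists_isPath
  refine (hwalk w).trans ?_
  rw [← List.sum_toFinset _ hw.isTrail.edges_nodup]
  refine Finset.sum_le_sum_of_subset_of_nonneg (fun e he => ?_) fun e _ _ => variation_nonneg f e
  have h1 := w.edges_subset_edgeSet (List.mem_toFinset.mp he)
  rw [hΓ, SimpleGraph.edgeSet_fromEdgeSet] at h1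
  exact h1.1

variable [MetricSpace V]

theorem dist_le_totalWeight {G : Finset (Sym2 V)} (hG : IsConnectedOn G) (u v : V) :
    dist u v ≤ totalWeight G := by
  have h1 := sub_le_sum_variation hG (fun x => dist x v) u v
  rw [dist_self, sub_zero] at h1
  refine h1.trans (Finset.sum_le_sum fun e _ => ?_)
  induction e with
  | _ p q => exact abs_dist_sub_le p q v

/-- Balls around separated points contain disjoint parts of a connected graph. -/
theorem card_mul_le_totalWeight {G : Finset (Sym2 V)} (hG : IsConnectedOn G) {s : ℝ}
    (hs : 0 ≤ s) {U : Finset V} (hU : ∀ u ∈ U, ∀ v ∈ U, u ≠ v → s ≤ dist u v) (hU2 : 2 ≤ U.card) :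
    U.card * s ≤ 4 * totalWeight G := by
  classical
  set f : V → V → ℝ := fun u x => max 0 (s / 2 - dist u x) with hf
  have h1 : ∀ u ∈ U, s / 2 ≤ ∑ e ∈ G, variation (f u) e := by
    intro u hu
    obtain ⟨v, hv, hne⟩ := Finset.exists_mem_ne hU2 u
    have h2 := sub_le_sum_variation hG (f u) u v
    have h3 : f u u = s / 2 := by simp [hf, div_nonneg hs]
    have h4 : f u v = 0 := by
      have := hU u hu v hv hne.symm
      exact max_eq_left (by linarith)
    rwa [h3, h4, sub_zero] at h2
  have hlip : ∀ u x y, |f u x - f u y| ≤ dist x y := by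
    intro u x y
    refine (abs_max_sub_max_le_max _ _ _ _).trans ?_
    rw [sub_self, abs_zero, sub_sub_sub_cancel_left, max_eq_right (abs_nonneg _), dist_comm u,
      dist_comm u, abs_sub_comm]
    exact abs_dist_sub_le x y u
  have hball : ∀ x, {u ∈ U | dist u x < s / 2}.card ≤ 1 := by
    intro x
    rw [Finset.card_le_one]
    intro u hu v hv
    rw [Finset.mem_filter] at hu hv
    by_contra hne
    have h2 := hU u hu.1 v hv.1 hne
    have h3 := dist_triangle_right u v x
    linarith
  have hedge : ∀ e, ∑ u ∈ U, variation (f u) e ≤ 2 * edgeWeight e := by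
    intro e
    induction e with
    | _ x y =>
    change ∑ u ∈ U, |f u x - f u y| ≤ 2 * dist x y
    set A := {u ∈ U | dist u x < s / 2} ∪ {u ∈ U | dist u y < s / 2} with hA
    have hAU : A ⊆ U := Finset.union_subset (Finset.filter_subset _ _) (Finset.filter_subset _ _)
    rw [← Finset.sum_subset hAU]
    · refine (Finset.sum_le_card_nsmul _ _ _ fun u _ => hlip u x y).trans ?_
      rw [nsmul_eq_mul]
      refine mul_le_mul_of_nonneg_right ?_ dist_nonneg
      have h2 := (Finset.card_union_le {u ∈ U | dist u x < s / 2} {u ∈ U | dist u y < s / 2})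
      have h3 := hball x
      have h4 := hball y
      have h5 : A.card ≤ 2 := by rw [hA]; omega
      exact_mod_cast h5
    · intro u hu hnu
      simp only [hA, Finset.mem_union, Finset.mem_filter, hu, true_and, not_or, not_lt] at hnu
      have h2 : f u x = 0 := max_eq_left (by linarith)
      have h3 : f u y = 0 := max_eq_left (by linarith)
      rw [h2, h3, sub_self, abs_zero]
  have h2 : U.card * (s / 2) ≤ ∑ u ∈ U, ∑ e ∈ G, variation (f u) e := by
    rw [← nsmul_eq_mul]
    exact Finset.card_nsmul_le_sum _ _ _ h1
  rw [Finset.sum_comm] at h2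
  have h3 : ∑ e ∈ G, ∑ u ∈ U, variation (f u) e ≤ 2 * totalWeight G := by
    rw [totalWeight, Finset.mul_sum]
    exact Finset.sum_le_sum fun e _ => hedge e
  linarith

theorem le_mstWeight [Fintype V] [Nonempty V] {w : ℝ}
    (h : ∀ G : Finset (Sym2 V), IsConnectedOn G → w ≤ totalWeight G) : w ≤ mstWeight V := by
  classical
  refine le_csInf ?_ ?_
  · obtain ⟨o⟩ := ‹Nonempty V›
    set G : Finset (Sym2 V) := (Finset.univ.erase o).image fun x => s(o, x) with hG
    have hmem : ∀ x, x ≠ o → s(o, x) ∈ G := fun x hx =>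
      Finset.mem_image_of_mem _ (Finset.mem_erase.mpr ⟨hx, Finset.mem_univ x⟩)
    refine ⟨_, G, ?_, ?_, ?_, rfl⟩
    · intro e he
      obtain ⟨x, hx, rfl⟩ := Finset.mem_image.mp he
      rw [Sym2.mk_isDiag_iff]
      exact (Finset.ne_of_mem_erase hx).symm
    · intro p q
      have hc : ∀ x, Conn {e | e ∈ G ∨ e.IsDiag} 1 (dist o x) o x := by
        intro x
        apply Conn.of_mem
        by_cases hx : x = o
        · subst hx
          simp
        · simp [hmem x hx]
      obtain ⟨k, -, x, h1, h2, h3, -⟩ := ((hc p).symm.trans (hc q)).exists_walk (H' := G) (by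
        intro e he hd
        simp only [Finset.mem_filter, Finset.mem_univ, true_and] at he
        exact he.resolve_right hd)
      exact ⟨k, x, h1, h2, h3⟩
    · rw [hG, Finset.card_image_of_injective _ fun x y hxy => Sym2.congr_right.mp hxy,
        Finset.card_erase_of_mem (Finset.mem_univ o), Finset.card_univ]
  · rintro _ ⟨G, -, hG, -, rfl⟩
    exact h G hG

end SpanningTrees

namespace Hierarchy

variable {V : Type} [MetricSpace V] [Fintype V] {R κ : ℕ} (T : Hierarchy V R κ)

/-- The scales of the parts of a fixed level sum up to a multiple of the weight of any connected
graph. -/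
theorem card_mul_scale_le (hR : 1 ≤ R) {C : ℝ} (hC : 0 ≤ C) (hS₀ : ∃ x y : V, T.S₀ ≤ C * dist x y)
    {G : Finset (Sym2 V)} (hG : IsConnectedOn G) (ℓ : ℕ) {F : Finset (Finset V)}
    (hF : ∀ S ∈ F, ∃ x, T.Q ℓ x = S) :
    F.card * (T.S₀ / 2 ^ ℓ) ≤ κ * (4 + C) * totalWeight G := by
  classical
  have hw : 0 ≤ totalWeight G := Finset.sum_nonneg fun e _ => edgeWeight_nonneg e
  have hs := T.scale_nonneg ℓ
  set s := T.S₀ / 2 ^ ℓ with hsdef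
  obtain ⟨U, -, hU⟩ := Finset.exists_le_maximal
    (s := {U : Finset V | ∀ u ∈ U, ∀ v ∈ U, u ≠ v → s ≤ dist u v}.toFinset) (a := ∅) (by simp)
  have hsep := Set.mem_toFinset.mp hU.prop
  have hcov : ∀ x, ∃ u ∈ U, dist u x ≤ s := by
    intro x
    by_contra! hcon
    have hx : x ∉ U := fun hx => by
      have := hcon x hx
      rw [dist_self] at this
      linarith
    refine hx (hU.le_of_ge (y := insert x U) ?_ (Finset.subset_insert x U)
      (Finset.mem_insert_self x U))
    rw [Set.mem_toFinset]
    intro u hu v hv hne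
    rw [Finset.mem_insert] at hu hv
    rcases hu with rfl | hu <;> rcases hv with rfl | hv
    · exact absurd rfl hne
    · rw [dist_comm]; exact (hcon v hv).le
    · exact (hcon u hu).le
    · exact hsep u hu v hv hne
  have hcard : F.card ≤ U.card * κ := by
    have hex : ∀ S : Finset V, ∃ u, S ∈ F → u ∈ U ∧ ∃ x, dist u x ≤ s ∧ T.Q ℓ x = S := by
      intro S
      by_cases hS : S ∈ F
      · obtain ⟨x, rfl⟩ := hF S hS
        obtain ⟨u, hu, hux⟩ := hcov x
        exact ⟨u, fun _ => ⟨hu, x, hux, rfl⟩⟩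
      · obtain ⟨x, -⟩ := hS₀
        exact ⟨x, fun h => absurd h hS⟩
    choose g hg using hex
    have h1 : F.card ≤ κ * (F.image g).card := by
      refine Finset.card_le_mul_card_image (f := g) F κ fun u _ => ?_
      refine T.card_clusters_filter_le ℓ u _ fun S hS => ?_
      obtain ⟨hSF, rfl⟩ := Finset.mem_filter.mp hS
      obtain ⟨-, x, hx, hxS⟩ := hg S hSF
      refine ⟨x, hx.trans ?_, hxS⟩
      have : (1 : ℝ) ≤ R := by exact_mod_cast hR
      nlinarith
    have h2 : (F.image g).card ≤ U.card := Finset.card_le_card fun u hu => by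
      obtain ⟨S, hS, rfl⟩ := Finset.mem_image.mp hu
      exact (hg S hS).1
    rw [mul_comm]
    exact h1.trans (Nat.mul_le_mul_left κ h2)
  have hUs : U.card * s ≤ (4 + C) * totalWeight G := by
    rcases le_or_gt 2 U.card with h2 | h2
    · have := card_mul_le_totalWeight hG hs hsep h2
      nlinarith
    · obtain ⟨x, y, hxy⟩ := hS₀
      have h3 := dist_le_totalWeight hG x y
      have h4 : s ≤ T.S₀ / 2 ^ 0 := T.scale_anti (Nat.zero_le ℓ)
      rw [pow_zero, div_one] at h4
      have h5 : (U.card : ℝ) ≤ 1 := by exact_mod_cast (show U.card ≤ 1 by omega)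
      nlinarith
  have h1 : (F.card : ℝ) ≤ U.card * κ := by exact_mod_cast hcard
  calc (F.card : ℝ) * s ≤ U.card * κ * s := by gcongr
    _ = κ * (U.card * s) := by ring
    _ ≤ κ * ((4 + C) * totalWeight G) := by gcongr
    _ = _ := by ring

theorem sum_scale_le [Nonempty V] (hR : 1 ≤ R) {C : ℝ} (hC : 0 ≤ C)
    (hS₀ : ∃ x y : V, T.S₀ ≤ C * dist x y) :
    ∑ S ∈ T.clusters, T.S₀ / 2 ^ T.lev S ≤
      (Nat.log 2 (Fintype.card V) + 1) * (κ * (4 + C) + 2 * C) * mstWeight V := by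
  classical
  set b := Nat.log 2 (Fintype.card V) + 1 with hb
  have hb1 : (1 : ℝ) ≤ b := by exact_mod_cast (show 1 ≤ b by omega)
  have hbc : ((Nat.log 2 (Fintype.card V) : ℝ) + 1) = b := by rw [hb]; push_cast; ring
  rw [hbc]
  have hK : 0 < b * (κ * (4 + C) + 2 * C) ∨ b * (κ * (4 + C) + 2 * C) = 0 := by
    refine lt_or_eq_of_le ?_ |>.imp id Eq.symm
    positivity
  have main : ∀ G : Finset (Sym2 V), IsConnectedOn G →
      ∑ S ∈ T.clusters, T.S₀ / 2 ^ T.lev S ≤ b * (κ * (4 + C) + 2 * C) * totalWeight G := by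
    intro G hG
    have hw : 0 ≤ totalWeight G := Finset.sum_nonneg fun e _ => edgeWeight_nonneg e
    have hpos := T.S₀_pos
    rw [← Finset.sum_filter_add_sum_filter_not T.clusters (fun S => T.lev S < b)]
    have h1 : ∑ S ∈ T.clusters with T.lev S < b, T.S₀ / 2 ^ T.lev S ≤
        b * (κ * (4 + C) * totalWeight G) := by
      rw [← Finset.sum_fiberwise_of_maps_to (g := T.lev) (t := Finset.range b) fun S hS =>
        Finset.mem_range.mpr (Finset.mem_filter.mp hS).2]
      refine (Finset.sum_le_card_nsmul _ _ (κ * (4 + C) * totalWeight G) fun ℓ _ => ?_).trans ?_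
      · rw [Finset.sum_congr rfl (g := fun _ => T.S₀ / 2 ^ ℓ) fun S hS => by
          rw [(Finset.mem_filter.mp hS).2], Finset.sum_const, nsmul_eq_mul]
        refine T.card_mul_scale_le hR hC hS₀ hG ℓ fun S hS => ?_
        obtain ⟨h1, rfl⟩ := Finset.mem_filter.mp hS
        have h2 := (Finset.mem_filter.mp h1).1
        obtain ⟨x, hx⟩ := T.nonempty_of_mem h2
        exact ⟨x, T.Q_lev h2 hx⟩
      · rw [Finset.card_range, nsmul_eq_mul]
    have h2 : ∑ S ∈ T.clusters with ¬ T.lev S < b, T.S₀ / 2 ^ T.lev S ≤ 2 * T.S₀ := by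
      refine (Finset.sum_le_card_nsmul _ _ (T.S₀ / 2 ^ b) fun S hS =>
        T.scale_anti (by have := (Finset.mem_filter.mp hS).2; omega)).trans ?_
      rw [nsmul_eq_mul, mul_div_assoc', div_le_iff₀ (by positivity)]
      have h3 : Finset.card {S ∈ T.clusters | ¬ T.lev S < b} ≤ 2 * 2 ^ b := by
        have h4 := T.card_clusters_le
        have h5 := Finset.card_filter_le T.clusters (fun S => ¬ T.lev S < b)
        have h6 : Fintype.card V < 2 ^ b := Nat.lt_pow_succ_log_self (by omega) _
        omega
      have h4 : ((Finset.card {S ∈ T.clusters | ¬ T.lev S < b} : ℕ) : ℝ) ≤ 2 * 2 ^ b := by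
        exact_mod_cast h3
      nlinarith
    have h3 : T.S₀ ≤ C * totalWeight G := by
      obtain ⟨x, y, hxy⟩ := hS₀
      exact hxy.trans (mul_le_mul_of_nonneg_left (dist_le_totalWeight hG x y) hC)
    have h4 : C * totalWeight G ≤ b * (C * totalWeight G) :=
      le_mul_of_one_le_left (by positivity) hb1
    linarith
  rcases hK with hK | hK
  · rw [mul_comm, ← div_le_iff₀ hK]
    refine le_mstWeight fun G hG => ?_
    rw [div_le_iff₀ hK, mul_comm]
    exact main G hG
  · rw [hK, zero_mul]
    obtain ⟨G, hG⟩ : ∃ G : Finset (Sym2 V), IsConnectedOn G := by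
      refine ⟨Finset.univ, fun p q => ⟨1, ![p, q], rfl, rfl, fun i => Finset.mem_univ _⟩⟩
    have := main G hG
    rwa [hK, zero_mul] at this

end Hierarchy

theorem floor_eq_of_floor_two_mul_eq {a b : ℝ} (h : ⌊2 * a⌋ = ⌊2 * b⌋) : ⌊a⌋ = ⌊b⌋ := by
  have key : ∀ c : ℝ, ⌊c⌋ = ⌊2 * c⌋ / 2 := by
    intro c
    rw [Int.floor_eq_iff]
    have h1 := Int.floor_le (2 * c)
    have h2 := Int.lt_floor_add_one (2 * c)
    set m := ⌊2 * c⌋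
    have h3 : 2 * (m / 2) ≤ m := by omega
    have h4 : m + 1 ≤ 2 * (m / 2) + 2 := by omega
    have h5 : (2 : ℝ) * ((m / 2 : ℤ) : ℝ) ≤ m := by exact_mod_cast h3
    have h6 : (m : ℝ) + 1 ≤ 2 * ((m / 2 : ℤ) : ℝ) + 2 := by exact_mod_cast h4
    constructor <;> linarith
  rw [key a, key b, h]

theorem abs_sub_lt_one_of_floor_eq {a b : ℝ} (h : ⌊a⌋ = ⌊b⌋) : |a - b| < 1 := by
  have h1 := Int.floor_le a
  have h2 := Int.lt_floor_add_one a
  have h3 := Int.floor_le b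
  have h4 := Int.lt_floor_add_one b
  rw [h] at h1 h2
  rw [abs_lt]
  constructor <;> linarith

theorem floor_mem_Icc {a b : ℝ} {m : ℕ} (h : |a - b| ≤ m) : ⌊b⌋ ∈ Finset.Icc (⌊a⌋ - m) (⌊a⌋ + m) := by
  have h1 := Int.floor_le a
  have h2 := Int.lt_floor_add_one a
  have h3 := Int.floor_le b
  have h4 := Int.lt_floor_add_one b
  rw [abs_le] at h
  have h5 : ((⌊a⌋ - m : ℤ) : ℝ) < ((⌊b⌋ + 1 : ℤ) : ℝ) := by push_cast; linarith
  have h6 : (⌊b⌋ : ℝ) < ((⌊a⌋ + m + 1 : ℤ) : ℝ) := by push_cast; linarith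
  rw [Int.cast_lt] at h5 h6
  rw [Finset.mem_Icc]
  omega

/-- The dyadic grid hierarchy of a finite metric space with coordinates. -/
theorem exists_hierarchy {V : Type} [MetricSpace V] [Fintype V] [Nontrivial V] {d : ℕ}
    (hd : 1 ≤ d) (R : ℕ) (f : V → Fin d → ℝ) (hle : ∀ x y i, |f x i - f y i| ≤ dist x y)
    (hge : ∀ x y, dist x y ≤ ∑ i, |f x i - f y i|) :
    ∃ T : Hierarchy V R ((2 * (R * d) + 1) ^ d), ∃ x y : V, T.S₀ ≤ 4 * d * dist x y := by
  classical
  obtain ⟨⟨x₀, y₀⟩, -, hmax⟩ := Finset.exists_max_image (Finset.univ : Finset (V × V))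
    (fun p => dist p.1 p.2) ⟨Classical.arbitrary _, Finset.mem_univ _⟩
  obtain ⟨a, b, hab⟩ := exists_pair_ne V
  obtain ⟨⟨x₁, y₁⟩, hxy₁, hmin⟩ := Finset.exists_min_image (Finset.univ : Finset V).offDiag
    (fun p => dist p.1 p.2) ⟨(a, b), by simp [hab]⟩
  set D := dist x₀ y₀ with hD
  have hDmax : ∀ x y, dist x y ≤ D := fun x y => hmax (x, y) (Finset.mem_univ _)
  have hDpos : 0 < D := (dist_pos.mpr hab).trans_le (hDmax a b)
  have hmpos : 0 < dist x₁ y₁ := dist_pos.mpr (Finset.mem_offDiag.mp hxy₁).2.2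
  have hmin' : ∀ x y, x ≠ y → dist x₁ y₁ ≤ dist x y := fun x y hxy => hmin (x, y) (by simp [hxy])
  have hdpos : (0 : ℝ) < d := by exact_mod_cast hd
  set g : ℕ → V → Fin d → ℝ := fun ℓ x i => 2 ^ ℓ * ((f x i - f x₀ i + D) / (4 * D)) with hg
  set cell : ℕ → V → Fin d → ℤ := fun ℓ x i => ⌊g ℓ x i⌋ with hcell
  have hgsub : ∀ ℓ x y i, |f x i - f y i| = |g ℓ x i - g ℓ y i| * (4 * D / 2 ^ ℓ) := by
    intro ℓ x y i
    have h1 : f x i - f y i = (g ℓ x i - g ℓ y i) * (4 * D / 2 ^ ℓ) := by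
      simp only [hg]
      field_simp
      ring
    rw [h1, abs_mul, abs_of_pos (show 0 < 4 * D / 2 ^ ℓ by positivity)]
  set Q : ℕ → V → Finset V := fun ℓ x => {y | cell ℓ y = cell ℓ x} with hQ
  have hmem : ∀ {ℓ x y}, y ∈ Q ℓ x ↔ cell ℓ y = cell ℓ x := by
    intro ℓ x y
    simp [hQ]
  have hdist : ∀ {ℓ x y}, y ∈ Q ℓ x → dist x y ≤ 4 * d * D / 2 ^ ℓ := by
    intro ℓ x y hy
    rw [hmem] at hy
    refine (hge x y).trans ((Finset.sum_le_card_nsmul _ _ (4 * D / 2 ^ ℓ) fun i _ => ?_).trans ?_)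
    · rw [hgsub ℓ]
      exact mul_le_of_le_one_left (by positivity)
        (abs_sub_lt_one_of_floor_eq (congrFun hy i).symm).le
    · rw [Finset.card_univ, Fintype.card_fin, nsmul_eq_mul]
      exact le_of_eq (by ring)
  obtain ⟨t, ht⟩ := pow_unbounded_of_one_lt (4 * d * D / dist x₁ y₁) (one_lt_two (α := ℝ))
  refine ⟨⟨Q, 4 * d * D, t, by positivity, fun ℓ x => hmem.mpr rfl, ?_, ?_, ?_, ?_, hdist, ?_⟩,
    x₀, y₀, le_rfl⟩
  · intro ℓ x y hy
    ext z
    rw [hmem, hmem, hmem.mp hy]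
  · intro ℓ x y hy
    rw [hmem] at hy ⊢
    funext i
    refine floor_eq_of_floor_two_mul_eq ?_
    have h1 := congrFun hy i
    simp only [hcell, hg, pow_succ'] at h1 ⊢
    rwa [mul_assoc, mul_assoc] at h1
  · intro x
    refine Finset.eq_univ_of_forall fun y => hmem.mpr ?_
    have h0 : ∀ z i, cell 0 z i = 0 := by
      intro z i
      simp only [hcell, hg, pow_zero, one_mul]
      have h1 := abs_le.mp ((hle z x₀ i).trans (hDmax z x₀))
      rw [Int.floor_eq_zero_iff]
      constructor
      · apply div_nonneg <;> linarith
      · rw [div_lt_one (by positivity)]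
        linarith
    funext i
    rw [h0, h0]
  · intro x
    refine Finset.eq_singleton_iff_unique_mem.mpr ⟨hmem.mpr rfl, fun y hy => ?_⟩
    by_contra hne
    have h1 := hdist hy
    have h2 := hmin' x y (Ne.symm hne)
    rw [div_lt_iff₀ hmpos] at ht
    rw [le_div_iff₀ (by positivity)] at h1
    have h3 : dist x₁ y₁ * 2 ^ t ≤ dist x y * 2 ^ t := by gcongr
    linarith
  · intro ℓ x
    have h1 : ({y | dist x y ≤ R * (4 * d * D / 2 ^ ℓ)}.toFinset.image (Q ℓ)) ⊆
        (Fintype.piFinset fun i => Finset.Icc (cell ℓ x i - (R * d : ℕ))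
          (cell ℓ x i + (R * d : ℕ))).image fun c => ({y | cell ℓ y = c} : Finset V) := by
      intro S hS
      obtain ⟨y, hy, rfl⟩ := Finset.mem_image.mp hS
      refine Finset.mem_image.mpr ⟨cell ℓ y, Fintype.mem_piFinset.mpr fun i => ?_, rfl⟩
      refine floor_mem_Icc ?_
      have hy' : dist x y ≤ R * (4 * d * D / 2 ^ ℓ) := by simpa using hy
      have h2 := (hle x y i).trans hy'
      rw [hgsub ℓ] at h2
      refine le_of_mul_le_mul_right (h2.trans (le_of_eq ?_)) (show 0 < 4 * D / 2 ^ ℓ by positivity)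
      push_cast
      ring
    refine le_trans ?_ ((Finset.card_le_card h1).trans (Finset.card_image_le.trans ?_))
    · apply le_of_eq
      congr!
    · rw [Fintype.card_piFinset]
      refine le_of_eq ((Finset.prod_congr rfl fun i _ => ?_).trans
        ((Finset.prod_const (2 * (R * d) + 1)).trans (by simp)))
      rw [Int.card_Icc]
      omega

theorem exists_hierarchy_euclidean {d : ℕ} (hd : 1 ≤ d) (R : ℕ)
    (P : Finset (EuclideanSpace ℝ (Fin d))) (hP : 2 ≤ P.card) :
    ∃ T : Hierarchy {x // x ∈ P} R ((2 * (R * d) + 1) ^ d),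
      ∃ x y : {x // x ∈ P}, T.S₀ ≤ 4 * d * dist x y := by
  have : Nontrivial {x // x ∈ P} := by
    obtain ⟨a, ha, b, hb, hab⟩ := Finset.one_lt_card.mp hP
    exact ⟨⟨a, ha⟩, ⟨b, hb⟩, fun h => hab (congrArg Subtype.val h)⟩
  refine exists_hierarchy hd R (fun x i => x.1 i) (fun x y i => ?_) fun x y => ?_
  · rw [Subtype.dist_eq, dist_eq_norm]
    exact PiLp.norm_apply_le (x.1 - y.1) i
  · rw [Subtype.dist_eq, EuclideanSpace.dist_eq]
    refine Real.sqrt_le_iff.mpr ⟨Finset.sum_nonneg fun i _ => abs_nonneg _, ?_⟩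
    refine Finset.sum_sq_le_sq_sum_of_nonneg fun i _ => abs_nonneg _

/-- An integer comparable to the fourth root of `ρ`. -/
theorem exists_base {ρ : ℝ} (hρ : 2 ≤ ρ) : ∃ r : ℕ, 2 ≤ r ∧ r ≤ ⌈ρ⌉₊ ∧ (r : ℝ) ≤ 2 * ρ ∧
    (r : ℝ) ^ 2 ≤ 4 * √ρ ∧ Real.log ρ ≤ 4 * Real.log r := by
  have hs : 1 < √ρ := Real.lt_sqrt_of_sq_lt (by linarith)
  have hs2 : √ρ ^ 2 = ρ := Real.sq_sqrt (by linarith)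
  set a := √√ρ with ha
  have ha1 : 1 < a := Real.lt_sqrt_of_sq_lt (by linarith)
  have ha2 : a ^ 2 = √ρ := Real.sq_sqrt (by linarith)
  have haρ : a ≤ ρ := by nlinarith
  have h1 := Nat.le_ceil a
  have h2 := (Nat.ceil_lt_add_one (show 0 ≤ a by linarith)).le
  refine ⟨⌈a⌉₊, ?_, Nat.ceil_mono haρ, by linarith, ?_, ?_⟩
  · exact Nat.lt_ceil.mpr (by simpa using ha1)
  · rw [← ha2]
    nlinarith
  · have h3 : Real.log ρ = 4 * Real.log a := by
      rw [← hs2, ← ha2, ← pow_mul, Real.log_pow]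
      norm_num
    rw [h3]
    have := Real.log_le_log (by linarith) h1
    linarith

theorem natLog_le_mul_logb {ρ : ℝ} (hρ : 2 ≤ ρ) {r : ℕ} (hr : Real.log ρ ≤ 4 * Real.log r)
    {n K m : ℕ} (hn : 2 ≤ n) (hK : 1 ≤ K) (hm : m ≤ K * n) :
    (Nat.log r m : ℝ) ≤ (4 + 4 * Real.logb 2 K) * Real.logb ρ n := by
  have hlog2 : 0 < Real.log 2 := Real.log_pos (by norm_num)
  have hlogρ : 0 < Real.log ρ := Real.log_pos (by linarith)
  have hn' : (2 : ℝ) ≤ n := by exact_mod_cast hn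
  have hK' : (1 : ℝ) ≤ K := by exact_mod_cast hK
  have hlogn : Real.log 2 ≤ Real.log n := Real.log_le_log (by norm_num) hn'
  have hb : 0 ≤ Real.logb 2 K := Real.logb_nonneg (by norm_num) hK'
  have hL : 0 ≤ Real.logb ρ n := Real.logb_nonneg (by linarith) (by linarith)
  rcases Nat.eq_zero_or_pos m with rfl | hm0
  · simp only [Nat.log_zero_right, Nat.cast_zero]
    positivity
  have h1 : Nat.log r m * Real.log r ≤ Real.log m := by
    rw [← Real.log_pow]
    have hr0 : 0 < (r : ℝ) := by
      rcases Nat.eq_zero_or_pos r with rfl | h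
      · simp at hr
        linarith
      · exact_mod_cast h
    exact Real.log_le_log (by positivity) (by exact_mod_cast Nat.pow_log_le_self r hm0.ne')
  have h2 : Real.log m ≤ Real.log K + Real.log n := by
    rw [← Real.log_mul (by positivity) (by positivity)]
    exact Real.log_le_log (by exact_mod_cast hm0) (by exact_mod_cast hm)
  have h3 : Real.log K = Real.logb 2 K * Real.log 2 := by
    rw [Real.logb, div_mul_cancel₀ _ hlog2.ne']
  have h4 : Real.log n = Real.logb ρ n * Real.log ρ := by
    rw [Real.logb, div_mul_cancel₀ _ hlogρ.ne']
  have h5 : Real.log K ≤ Real.logb 2 K * Real.log n := by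
    rw [h3]
    gcongr
  refine le_of_mul_le_mul_right ?_ hlogρ
  calc (Nat.log r m : ℝ) * Real.log ρ ≤ Nat.log r m * (4 * Real.log r) := by gcongr
    _ ≤ 4 * (Real.logb 2 K * Real.log n + Real.log n) := by linarith
    _ = _ := by rw [h4]; ring

theorem natLog_two_add_one_le {ρ : ℝ} (hρ : 2 ≤ ρ) {n : ℕ} (hn : 2 ≤ n) :
    (Nat.log 2 n : ℝ) + 1 ≤ 6 * √ρ * Real.logb ρ n := by
  have hlogρ : 0 < Real.log ρ := Real.log_pos (by linarith)
  have hn' : (2 : ℝ) ≤ n := by exact_mod_cast hn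
  have hlog2 := Real.log_two_gt_d9
  have hlogn : Real.log 2 ≤ Real.log n := Real.log_le_log (by norm_num) hn'
  have h1 : Nat.log 2 n * Real.log 2 ≤ Real.log n := by
    rw [← Real.log_pow]
    refine Real.log_le_log (by positivity) ?_
    exact_mod_cast Nat.pow_log_le_self 2 (by omega)
  have h2 : (Nat.log 2 n : ℝ) + 1 ≤ 3 * Real.log n := by
    have : (Nat.log 2 n : ℝ) * (2 / 3) ≤ Nat.log 2 n * Real.log 2 := by
      gcongr
      linarith
    linarith
  have h3 : Real.log ρ ≤ 2 * √ρ := by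
    have h4 := Real.log_le_self (Real.sqrt_nonneg ρ)
    rw [Real.log_sqrt (by linarith)] at h4
    linarith
  have h4 : Real.log n = Real.logb ρ n * Real.log ρ := by
    rw [Real.logb, div_mul_cancel₀ _ hlogρ.ne']
  have hL : 0 ≤ Real.logb ρ n := Real.logb_nonneg (by linarith) (by linarith)
  rw [h4] at h2
  nlinarith [mul_le_mul_of_nonneg_left h3 hL]

theorem invAck_spec (x : ℝ) : 1 ≤ invAck x ∧ x ≤ ack (invAck x) (invAck x) := by
  refine Nat.sInf_mem (s := {k : ℕ | 1 ≤ k ∧ x ≤ ack k k}) ⟨⌈x⌉₊ + 1, by omega, ?_⟩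
  refine (Nat.le_ceil x).trans ?_
  exact_mod_cast (Nat.le_succ _).trans (lt_ack_right _ _).le

/-- The spanner built from a hierarchy, with its parameters expressed through `ρ`. -/
theorem Hierarchy.exists_spanner_logb {V : Type} [MetricSpace V] [Fintype V] {R κ : ℕ}
    (T : Hierarchy V R κ) (hκ : 1 ≤ κ) (hV : 2 ≤ Fintype.card V) {c J : ℕ} (hc : 2 ≤ c)
    (hJ : 0 < J) (hR : 2 * c + 1 ≤ R) {D : ℝ} (hD : 0 ≤ D)
    (hS₀ : ∃ x y : V, T.S₀ ≤ D * dist x y) {ρ : ℝ} (hρ : 2 ≤ ρ) :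
    ∃ H : Finset (Sym2 V), IsGraphOn H ∧
      (H.card : ℝ) ≤ (48 + 2 * κ) * Fintype.card V ∧
      (∀ p, (degree H p : ℝ) ≤ 2 * κ * (28 + 4 * J) * ρ) ∧
      (∀ p q, ∃ m : ℕ, (m : ℝ) ≤ (61 + 4 * Real.logb 2 (2 * κ : ℕ)) *
          (Real.logb ρ (Fintype.card V) + invAck ρ) ∧
        IsSpannerPath H (1 + 26 / c + 32 / 2 ^ J) p q m) ∧
      totalWeight H ≤ 24 * ((7 + κ * (4 * c + 4)) * (κ * (4 + D) + 2 * D)) * ρ *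
        Real.logb ρ (Fintype.card V) * mstWeight V := by
  classical
  obtain ⟨r, hr2, hrρ, hr2ρ, hrsq, hrlog⟩ := exists_base hρ
  obtain ⟨hk1, hk⟩ := invAck_spec ρ
  have : Nonempty V := Fintype.card_pos_iff.mp (by omega)
  obtain ⟨G, hG1, hG2, hG3, hG4⟩ :=
    T.exists_spanner hr2 (hrρ.trans (Nat.ceil_le.mpr hk)) hc hJ hR
  have hcl : T.clusters.card ≤ 2 * Fintype.card V := T.card_clusters_le
  have hL0 : 0 ≤ Real.logb ρ (Fintype.card V) :=
    Real.logb_nonneg (by linarith) (by exact_mod_cast (show 1 ≤ Fintype.card V by omega))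
  have hmst : 0 ≤ mstWeight V :=
    le_mstWeight fun G _ => Finset.sum_nonneg fun e _ => edgeWeight_nonneg e
  refine ⟨{e ∈ G | ¬ e.IsDiag}, fun e he => (Finset.mem_filter.mp he).2, ?_, ?_, ?_, ?_⟩
  · have h1 : (G.filter fun e => ¬ e.IsDiag).card ≤ (48 + 2 * κ) * Fintype.card V := by
      refine (Finset.card_filter_le _ _).trans (hG1.trans ?_)
      have := Nat.mul_le_mul_left (2 + κ) hcl
      linarith
    exact_mod_cast h1
  · intro p
    have h1 : degree (G.filter fun e => ¬ e.IsDiag) p ≤ κ * (28 + 4 * J) * r := by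
      refine le_trans (le_trans ?_ (hG2 p)) ?_
      · unfold degree
        convert Finset.card_le_card
          (Finset.filter_subset_filter (fun e => p ∈ e) (Finset.filter_subset _ G))
      · have h2 : r ≤ κ * r := Nat.le_mul_of_pos_left r hκ
        have h3 : κ * 2 ≤ κ * r := Nat.mul_le_mul_left κ hr2
        linarith
    calc (degree (G.filter fun e => ¬ e.IsDiag) p : ℝ) ≤ κ * (28 + 4 * J) * r := by
          exact_mod_cast h1
      _ ≤ κ * (28 + 4 * J) * (2 * ρ) := by gcongr
      _ = 2 * κ * (28 + 4 * J) * ρ := by ring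
  · intro p q
    obtain ⟨m, hm, x, h0, h1, h2, h3⟩ := (hG4 p q).exists_walk
      (H' := ({e ∈ G | ¬ e.IsDiag} : Finset (Sym2 V)))
      fun e he hd => Finset.mem_filter.mpr ⟨he, hd⟩
    refine ⟨m, ?_, x, h0, h1, h2, h3⟩
    have hclκ : κ * T.clusters.card ≤ 2 * κ * Fintype.card V := by
      have := Nat.mul_le_mul_left κ hcl
      linarith
    have e1 := natLog_le_mul_logb hρ hrlog hV le_rfl (m := Fintype.card V) (by omega)
    have e2 := natLog_le_mul_logb hρ hrlog hV one_le_two (m := T.clusters.card) hcl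
    have e3 := natLog_le_mul_logb hρ hrlog hV (K := 2 * κ) (by omega) hclκ
    rw [Nat.cast_one, Real.logb_one, mul_zero, add_zero] at e1
    rw [Nat.cast_ofNat, Real.logb_self_eq_one (by norm_num)] at e2
    have hm' : (m : ℝ) ≤ 6 * Nat.log r (Fintype.card V) + 4 * invAck ρ + 13 +
        2 * Nat.log r T.clusters.card + Nat.log r (κ * T.clusters.card) := by exact_mod_cast hm
    have hk1' : (1 : ℝ) ≤ invAck ρ := by exact_mod_cast hk1
    have hb : 0 ≤ Real.logb 2 (2 * κ : ℕ) :=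
      Real.logb_nonneg (by norm_num) (by exact_mod_cast (show 1 ≤ 2 * κ by omega))
    have hbk : 0 ≤ Real.logb 2 (2 * κ : ℕ) * invAck ρ := by positivity
    linarith
  · have h1 := T.sum_scale_le (by omega) hD hS₀
    have h2 := natLog_two_add_one_le hρ hV
    have hr1 : (1 : ℝ) ≤ r ^ 2 := one_le_pow₀ (by exact_mod_cast (show 1 ≤ r by omega))
    have h3 : (r : ℝ) ^ 2 + 6 + κ * (4 * c + 4) ≤ (7 + κ * (4 * c + 4)) * r ^ 2 := by
      have : (κ : ℝ) * (4 * c + 4) * 1 ≤ κ * (4 * c + 4) * r ^ 2 := by gcongr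
      linarith
    have hsq : √ρ * √ρ = ρ := Real.mul_self_sqrt (by linarith)
    calc totalWeight (G.filter fun e => ¬ e.IsDiag) ≤ totalWeight G :=
          totalWeight_mono (Finset.filter_subset _ _)
      _ ≤ (r ^ 2 + 6 + κ * (4 * c + 4)) * ∑ S ∈ T.clusters, T.S₀ / 2 ^ T.lev S := hG3
      _ ≤ (7 + κ * (4 * c + 4)) * r ^ 2 * ((Nat.log 2 (Fintype.card V) + 1) *
          (κ * (4 + D) + 2 * D) * mstWeight V) :=
        mul_le_mul h3 h1 (Finset.sum_nonneg fun S _ => T.scale_nonneg _) (by positivity)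
      _ = (7 + κ * (4 * c + 4)) * (κ * (4 + D) + 2 * D) *
          (r ^ 2 * (Nat.log 2 (Fintype.card V) + 1)) * mstWeight V := by ring
      _ ≤ (7 + κ * (4 * c + 4)) * (κ * (4 + D) + 2 * D) *
          (4 * √ρ * (6 * √ρ * Real.logb ρ (Fintype.card V))) * mstWeight V := by gcongr
      _ = 24 * ((7 + κ * (4 * c + 4)) * (κ * (4 + D) + 2 * D)) * (√ρ * √ρ) *
          Real.logb ρ (Fintype.card V) * mstWeight V := by ring
      _ = _ := by rw [hsq]

/-- **Optimal Euclidean spanners.** For every dimension `d ≥ 1` and `ε > 0` there is a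
constant `C = C(d, ε) > 0` such that for every finite set `P` of `n ≥ 2` points in
`ℝ^d` and every `ρ ≥ 2` there is a `(1+ε)`-spanner for `P` with at most `C·n` edges,
degree at most `C·ρ`, hop-diameter at most `C·(log_ρ n + α(ρ))`, and lightness at most
`C·ρ·log_ρ n`. -/
theorem optimal_euclidean_spanners (d : ℕ) (hd : 1 ≤ d) (ε : ℝ) (hε : 0 < ε) :
    ∃ C : ℝ, 0 < C ∧
      ∀ P : Finset (EuclideanSpace ℝ (Fin d)), 2 ≤ P.card →
      ∀ ρ : ℝ, 2 ≤ ρ →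
      ∃ H : Finset (Sym2 {x : EuclideanSpace ℝ (Fin d) // x ∈ P}),
        IsGraphOn H ∧
        IsSpanner H (1 + ε) ∧
        (H.card : ℝ) ≤ C * P.card ∧
        (∀ p, (degree H p : ℝ) ≤ C * ρ) ∧
        (∀ p q, ∃ k : ℕ,
          (k : ℝ) ≤ C * (Real.logb ρ P.card + invAck ρ) ∧
          IsSpannerPath H (1 + ε) p q k) ∧
        totalWeight H ≤ C * ρ * Real.logb ρ P.card *
          mstWeight {x : EuclideanSpace ℝ (Fin d) // x ∈ P} := by
  obtain ⟨c, hc2, hc⟩ : ∃ c : ℕ, 2 ≤ c ∧ 26 / (c : ℝ) ≤ ε / 2 := by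
    refine ⟨max 2 ⌈52 / ε⌉₊, le_max_left _ _, ?_⟩
    have h1 : 52 / ε ≤ (max 2 ⌈52 / ε⌉₊ : ℕ) :=
      (Nat.le_ceil _).trans (by exact_mod_cast le_max_right _ _)
    have h2 : (0 : ℝ) < (max 2 ⌈52 / ε⌉₊ : ℕ) := by
      exact_mod_cast lt_of_lt_of_le two_pos (le_max_left _ _)
    rw [div_le_iff₀ hε] at h1
    rw [div_le_iff₀ h2]
    linarith
  obtain ⟨J, hJ0, hJ⟩ : ∃ J : ℕ, 0 < J ∧ 32 / (2 : ℝ) ^ J ≤ ε / 2 := by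
    obtain ⟨J, hJ⟩ := pow_unbounded_of_one_lt (64 / ε) (one_lt_two (α := ℝ))
    refine ⟨J + 1, by omega, ?_⟩
    rw [div_lt_iff₀ hε] at hJ
    rw [div_le_iff₀ (by positivity), pow_succ]
    nlinarith
  obtain ⟨κ, hκ⟩ : ∃ κ, κ = (2 * ((2 * c + 1) * d) + 1) ^ d := ⟨_, rfl⟩
  have hκ1 : 1 ≤ κ := hκ ▸ Nat.one_le_pow _ _ (by omega)
  have hc1 : 0 ≤ 48 + 2 * (κ : ℝ) := by positivity
  have hc2' : 0 ≤ 2 * (κ : ℝ) * (28 + 4 * J) := by positivity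
  have hc3 : 0 < 61 + 4 * Real.logb 2 (2 * κ : ℕ) := by
    have : 0 ≤ Real.logb 2 (2 * κ : ℕ) :=
      Real.logb_nonneg (by norm_num) (by exact_mod_cast (show 1 ≤ 2 * κ by omega))
    positivity
  have hc4 : 0 ≤ 24 * ((7 + (κ : ℝ) * (4 * c + 4)) * (κ * (4 + 4 * d) + 2 * (4 * d))) := by
    positivity
  refine ⟨(48 + 2 * κ) + 2 * κ * (28 + 4 * J) + (61 + 4 * Real.logb 2 (2 * κ : ℕ)) +
    24 * ((7 + κ * (4 * c + 4)) * (κ * (4 + 4 * d) + 2 * (4 * d))), by linarith,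
    fun P hP ρ hρ => ?_⟩
  have hT := exists_hierarchy_euclidean hd (2 * c + 1) P hP
  rw [← hκ] at hT
  obtain ⟨T, hS₀⟩ := hT
  have hn : Fintype.card {x // x ∈ P} = P.card := Fintype.card_coe P
  obtain ⟨H, hH, h1, h2, h3, h4⟩ :=
    T.exists_spanner_logb hκ1 (hn ▸ hP) hc2 hJ0 le_rfl (by positivity) hS₀ hρ
  rw [hn] at h1 h3 h4
  have hL0 : 0 ≤ Real.logb ρ P.card :=
    Real.logb_nonneg (by linarith) (by exact_mod_cast (show 1 ≤ P.card by omega))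
  have : Nonempty {x // x ∈ P} := Fintype.card_pos_iff.mp (by omega)
  have hmst : 0 ≤ mstWeight {x // x ∈ P} :=
    le_mstWeight fun G _ => Finset.sum_nonneg fun e _ => edgeWeight_nonneg e
  have hpath : ∀ p q m, IsSpannerPath H (1 + 26 / c + 32 / 2 ^ J) p q m →
      IsSpannerPath H (1 + ε) p q m := fun p q m ⟨x, hx0, hx1, hx2, hx3⟩ =>
    ⟨x, hx0, hx1, hx2, hx3.trans (mul_le_mul_of_nonneg_right (by linarith) dist_nonneg)⟩
  refine ⟨H, hH, fun p q => ?_, ?_, fun p => ?_, fun p q => ?_, ?_⟩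
  · obtain ⟨m, -, hm⟩ := h3 p q
    exact ⟨m, hpath p q m hm⟩
  · exact h1.trans (mul_le_mul_of_nonneg_right (by linarith) (Nat.cast_nonneg _))
  · exact (h2 p).trans (mul_le_mul_of_nonneg_right (by linarith) (by linarith))
  · obtain ⟨m, hm, hm'⟩ := h3 p q
    exact ⟨m, hm.trans (mul_le_mul_of_nonneg_right (by linarith) (by positivity)),
      hpath p q m hm'⟩
  · refine h4.trans ?_
    gcongr
    linarith

end Stmt0
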